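/- arXiv:2210.03064 — 2 statements merged into one kernel-verified Lean document; each statement's English description precedes it below -/
import Mathlib

section
/- For all integers 1 ≤ ℓ < k, every α > 0, and every ε ∈ (0, 1/10) there exists C = C(ε) such that the following holds. If 𝓗 is a k-uniform hypergraph on n ≥ C vertices with δ_ℓ(𝓗) ≥ (α + ε)·binom(n, k−ℓ), then there exist N ∈ ℕ and a probability distribution on decreasing sequences of vertex sets V(𝓗) = V₀ ⊇ V₁ ⊇ ⋯ ⊇ V_N = X with the following properties: (V1) for every 0 ≤ i < N, |V_{i+1}| = (1 ± ε²/N²)·ε²·|V_i|; (V2) n^{1/(k+2)} ≤ |X| ≤ n^{1/(k+1)}; (V3) for every ℓ-element set S ⊆ V(𝓗) and every 0 ≤ i ≤ N, deg_𝓗(S, V_i) ≥ (α + ε/2)·binom(|V_i|, k−ℓ); (V4) for every set of distinct vertices {v₁,…,v_m} ⊆ V(𝓗) and every vector x ∈ {0,…,N}^m, the probability that v_i ∈ V_{x_i} for all i ∈ [m] is at most ∏_{i=1}^m 2·ε^{2x_i} (which, by (V1), is at most ∏_{i=1}^m 4|V_{x_i}|/n on the support of the distribution). -/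
open Finset

/-- The degree of a vertex set `S` in the hypergraph `H`: the number of hyperedges containing `S`. -/
def hDeg {n : ℕ} (H : Finset (Finset (Fin n))) (S : Finset (Fin n)) : ℕ :=
  (H.filter (fun h => S ⊆ h)).card

/-- `deg_H(S, A)`: the number of hyperedges `h ∈ H` with `S ⊆ h` and `h \ S ⊆ A`. -/
def hDegOn {n : ℕ} (H : Finset (Finset (Fin n))) (S A : Finset (Fin n)) : ℕ :=
  (H.filter (fun h => S ⊆ h ∧ h \ S ⊆ A)).card

section ProductWeights

variable {V J : Type*} [Fintype V] [DecidableEq V] [Fintype J]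

theorem sum_prod_mul_prod (q : J → ℝ) (g : V → J → ℝ) :
    ∑ lam : V → J, (∏ v, q (lam v)) * ∏ v, g v (lam v) = ∏ v, ∑ j, q j * g v j := by
  rw [Finset.prod_univ_sum, Fintype.piFinset_univ]
  simp only [Finset.prod_mul_distrib]

/-- Chernoff bound for weighted sums over the coordinates whose label lies in a prescribed set. -/
theorem sum_prod_filter_le_exp (q : J → ℝ) (hq : ∀ j, 0 ≤ q j) (hq1 : ∑ j, q j = 1)
    (P : J → Prop) [DecidablePred P] (w : V → ℝ) (hw : ∀ v, |w v| ≤ 1) (η : ℝ) (hη : 0 < η)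
    (hη1 : η ≤ 1) :
    ∑ lam : V → J with (∑ j with P j, q j) * ∑ v, w v
        + η * ((∑ j with P j, q j) * Fintype.card V) < ∑ v with P (lam v), w v,
      ∏ v, q (lam v)
      ≤ Real.exp (-(η ^ 2 * ((∑ j with P j, q j) * Fintype.card V) / 4)) := by
  set p := ∑ j with P j, q j with hp
  have hp0 : 0 ≤ p := Finset.sum_nonneg fun j _ => hq j
  set n : ℝ := (Fintype.card V : ℝ)
  set s := η / 2 with hs
  have hmgf : ∑ lam : V → J, (∏ v, q (lam v)) * Real.exp (s * ∑ v with P (lam v), w v)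
      ≤ Real.exp (s * (p * ∑ v, w v) + s ^ 2 * (p * n)) := by
    have h1 : ∀ lam : V → J, Real.exp (s * ∑ v with P (lam v), w v)
        = ∏ v, (fun v j => if P j then Real.exp (s * w v) else 1) v (lam v) := by
      intro lam
      rw [Finset.mul_sum, Real.exp_sum, Finset.prod_filter]
    rw [Finset.sum_congr rfl fun lam _ => congrArg _ (h1 lam),
      sum_prod_mul_prod q fun v j => if P j then Real.exp (s * w v) else 1]
    have h2 : s * (p * ∑ v, w v) + s ^ 2 * (p * n) = ∑ v, p * (s * w v + s ^ 2) := by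
      rw [← Finset.mul_sum, Finset.sum_add_distrib, ← Finset.mul_sum]
      simp [n]
      ring
    rw [h2, Real.exp_sum]
    refine Finset.prod_le_prod (fun v _ => Finset.sum_nonneg fun j _ => mul_nonneg (hq j) ?_) ?_
    · split_ifs <;> positivity
    intro v _
    have h3 : ∑ j, q j * (if P j then Real.exp (s * w v) else 1)
        = 1 + p * (Real.exp (s * w v) - 1) := by
      have : 1 + p * (Real.exp (s * w v) - 1) = ∑ j, q j + p * (Real.exp (s * w v) - 1) := by
        rw [hq1]
      rw [this, hp, Finset.sum_mul, Finset.sum_filter, ← Finset.sum_add_distrib]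
      refine Finset.sum_congr rfl fun j _ => ?_
      split_ifs <;> ring
    have h4 : Real.exp (s * w v) - 1 ≤ s * w v + s ^ 2 := by
      have hsw : |s * w v| ≤ s := by
        rw [abs_mul, abs_of_pos (by positivity)]
        exact mul_le_of_le_one_right (by positivity) (hw v)
      have h5 := Real.abs_exp_sub_one_sub_id_le (x := s * w v) (by linarith)
      have h6 : (s * w v) ^ 2 ≤ s ^ 2 := by
        rw [← sq_abs]; gcongr
      linarith [le_abs_self (Real.exp (s * w v) - 1 - s * w v)]
    calc _ = 1 + p * (Real.exp (s * w v) - 1) := h3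
      _ ≤ 1 + p * (s * w v + s ^ 2) := by gcongr
      _ ≤ _ := by linarith [Real.add_one_le_exp (p * (s * w v + s ^ 2))]
  set t := p * ∑ v, w v + η * (p * n) with ht
  have hW : ∀ lam : V → J, 0 ≤ ∏ v, q (lam v) := fun lam => Finset.prod_nonneg fun v _ => hq _
  calc ∑ lam : V → J with t < ∑ v with P (lam v), w v, ∏ v, q (lam v)
      ≤ ∑ lam : V → J with t < ∑ v with P (lam v), w v,
          (∏ v, q (lam v)) * Real.exp (s * ∑ v with P (lam v), w v) * Real.exp (-(s * t)) := by
        refine Finset.sum_le_sum fun lam hlam => ?_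
        rw [mul_assoc, ← Real.exp_add]
        refine le_mul_of_one_le_right (hW lam) (Real.one_le_exp ?_)
        have := (Finset.mem_filter.1 hlam).2
        nlinarith
    _ ≤ ∑ lam : V → J,
          (∏ v, q (lam v)) * Real.exp (s * ∑ v with P (lam v), w v) * Real.exp (-(s * t)) := by
        refine Finset.sum_le_sum_of_subset_of_nonneg (Finset.filter_subset _ _) fun lam _ _ => ?_
        have := hW lam
        positivity
    _ ≤ Real.exp (s * (p * ∑ v, w v) + s ^ 2 * (p * n)) * Real.exp (-(s * t)) := by
        rw [← Finset.sum_mul]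
        gcongr
    _ = _ := by
        rw [← Real.exp_add, ht, hs]
        congr 1
        ring

end ProductWeights

theorem exists_weights_sum_ge_eq_pow (N : ℕ) (r : ℝ) (hr : 0 ≤ r) (hr1 : r ≤ 1) :
    ∃ q : Fin (N + 1) → ℝ, (∀ j, 0 ≤ q j) ∧
      ∀ i : Fin (N + 1), ∑ j with i ≤ j, q j = r ^ (i : ℕ) := by
  refine ⟨fun j => if (j : ℕ) < N then r ^ (j : ℕ) - r ^ ((j : ℕ) + 1) else r ^ N, ?_, ?_⟩
  · intro j
    dsimp only
    split_ifs
    · exact sub_nonneg.2 (pow_le_pow_of_le_one hr hr1 (Nat.le_succ _))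
    · positivity
  · intro i
    have key : ∀ M, ∀ i ≤ M,
        ∑ j ∈ Finset.range M, (if i ≤ j then r ^ j - r ^ (j + 1) else 0) = r ^ i - r ^ M := by
      intro M
      induction M with
      | zero => intro i hi; simp [Nat.le_zero.1 hi]
      | succ M ih =>
        intro i hi
        rw [Finset.sum_range_succ]
        rcases Nat.lt_or_ge M i with h | h
        · obtain rfl : i = M + 1 := by omega
          rw [Finset.sum_eq_zero]
          · simp
          · intro j hj
            rw [if_neg]
            have := Finset.mem_range.1 hj
            omega
        · rw [ih i h, if_pos h]; ring
    rw [Finset.sum_filter, Fin.sum_univ_castSucc]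
    have := key N i (by omega)
    rw [← Fin.sum_univ_eq_sum_range
      (fun j => if (i : ℕ) ≤ j then r ^ j - r ^ (j + 1) else 0)] at this
    simp only [Fin.le_def, Fin.val_castSucc, Fin.val_last, Fin.is_lt, if_true, lt_irrefl, if_false]
    rw [this, if_pos (by omega)]
    ring

theorem sum_biUnion_le_sum {ι κ : Type*} [DecidableEq κ] (s : Finset ι) (t : ι → Finset κ)
    (f : κ → ℝ) (hf : ∀ a, 0 ≤ f a) : ∑ a ∈ s.biUnion t, f a ≤ ∑ i ∈ s, ∑ a ∈ t i, f a := by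
  classical
  induction s using Finset.induction_on with
  | empty => simp
  | insert i s hi ih =>
    rw [Finset.biUnion_insert, Finset.sum_insert hi]
    have := Finset.sum_union_inter (s₁ := t i) (s₂ := s.biUnion t) (f := f)
    have := Finset.sum_nonneg fun a (_ : a ∈ t i ∩ s.biUnion t) => hf a
    linarith

/-- A random decreasing sequence of vertex sets in which every vertex lies in the `i`-th set with
probability `r ^ i` independently of the others, conditioned on the weights in `F` being well
distributed at every level. -/
theorem exists_nested_distribution (n N : ℕ) (r η : ℝ) (hr : 0 < r) (hr1 : r ≤ 1) (hη : 0 < η)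
    (hη1 : η ≤ 1) (F : Finset (Fin n → ℝ)) (hF : ∀ w ∈ F, ∀ v, |w v| ≤ 1)
    (hsmall : ((N : ℝ) + 1) * (F.card * Real.exp (-(η ^ 2 * (r ^ N * n) / 4))) ≤ 1 / 2) :
    ∃ μ : (Fin (N + 1) → Finset (Fin n)) → ℝ,
      (∀ f, 0 ≤ μ f) ∧ (∑ f : Fin (N + 1) → Finset (Fin n), μ f = 1) ∧
      (∀ f : Fin (N + 1) → Finset (Fin n), μ f ≠ 0 →
        f 0 = Finset.univ ∧ (∀ i : Fin N, f i.succ ⊆ f i.castSucc) ∧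
        ∀ i : Fin (N + 1), ∀ w ∈ F,
          ∑ v ∈ f i, w v ≤ r ^ (i : ℕ) * ∑ v, w v + η * (r ^ (i : ℕ) * n)) ∧
      (∀ (m : ℕ) (v : Fin m → Fin n) (x : Fin m → Fin (N + 1)), Function.Injective v →
        ∑ f ∈ Finset.univ.filter
            (fun f : Fin (N + 1) → Finset (Fin n) => ∀ i, v i ∈ f (x i)), μ f ≤
          ∏ i : Fin m, 2 * r ^ (x i : ℕ)) := by
  classical
  obtain ⟨q, hq, hqs⟩ := exists_weights_sum_ge_eq_pow N r hr.le hr1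
  have hq1 : ∑ j, q j = 1 := by simpa using hqs 0
  let W : (Fin n → Fin (N + 1)) → ℝ := fun lam => ∏ v, q (lam v)
  have hW : ∀ lam, 0 ≤ W lam := fun lam => Finset.prod_nonneg fun v _ => hq _
  let A : (Fin n → Fin (N + 1)) → Fin (N + 1) → Finset (Fin n) := fun lam i => {v | i ≤ lam v}
  let bad : Fin (N + 1) → (Fin n → ℝ) → Finset (Fin n → Fin (N + 1)) := fun i w =>
    {lam | r ^ (i : ℕ) * ∑ v, w v + η * (r ^ (i : ℕ) * n) < ∑ v ∈ A lam i, w v}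
  let good : Finset (Fin n → Fin (N + 1)) := {lam | ∀ i, ∀ w ∈ F, lam ∉ bad i w}
  have htot : ∑ lam, W lam = 1 := by
    have := sum_prod_mul_prod q (fun (_ : Fin n) _ => 1)
    simpa [hq1] using this
  have hbad : ∀ i, ∀ w ∈ F, ∑ lam ∈ bad i w, W lam ≤ Real.exp (-(η ^ 2 * (r ^ N * n) / 4)) := by
    intro i w hw
    have h := sum_prod_filter_le_exp q hq hq1 (fun j => i ≤ j) w (hF w hw) η hη hη1
    rw [hqs i, Fintype.card_fin] at h
    refine h.trans (Real.exp_le_exp.2 ?_)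
    have : r ^ N ≤ r ^ (i : ℕ) := pow_le_pow_of_le_one hr.le hr1 (by omega)
    gcongr
  have hgood : 1 / 2 ≤ ∑ lam ∈ good, W lam := by
    have h1 : ∑ lam ∈ goodᶜ, W lam ≤ 1 / 2 := by
      calc ∑ lam ∈ goodᶜ, W lam
          ≤ ∑ lam ∈ (Finset.univ ×ˢ F).biUnion fun z => bad z.1 z.2, W lam := by
            refine Finset.sum_le_sum_of_subset_of_nonneg ?_ fun lam _ _ => hW lam
            intro lam hlam
            simp only [good, Finset.mem_compl, Finset.mem_filter, Finset.mem_univ, true_and] at hlam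
            push Not at hlam
            obtain ⟨i, w, hw, h⟩ := hlam
            exact Finset.mem_biUnion.2 ⟨(i, w), by simp [hw], h⟩
        _ ≤ ∑ z ∈ Finset.univ ×ˢ F, ∑ lam ∈ bad z.1 z.2, W lam :=
            sum_biUnion_le_sum _ _ W hW
        _ ≤ ∑ z ∈ (Finset.univ : Finset (Fin (N + 1))) ×ˢ F,
              Real.exp (-(η ^ 2 * (r ^ N * n) / 4)) :=
            Finset.sum_le_sum fun z hz => hbad z.1 z.2 (Finset.mem_product.1 hz).2
        _ ≤ 1 / 2 := by
            rw [Finset.sum_const, Finset.card_product]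
            simp only [Finset.card_univ, Fintype.card_fin, nsmul_eq_mul]
            push_cast
            rw [mul_assoc]
            exact hsmall
    have h2 := Finset.sum_add_sum_compl good W
    linarith
  set Z := ∑ lam ∈ good, W lam with hZ
  have hZ0 : 0 < Z := by linarith
  let μ : (Fin (N + 1) → Finset (Fin n)) → ℝ := fun f => (∑ lam ∈ good with A lam = f, W lam) / Z
  have hμ : ∀ (P : (Fin (N + 1) → Finset (Fin n)) → Prop) [DecidablePred P],
      ∑ f with P f, μ f
      = (∑ lam ∈ good with P (A lam), W lam) / Z := by
    intro P _
    simp only [μ]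
    rw [← Finset.sum_div, Finset.sum_fiberwise_eq_sum_filter]
    simp
  refine ⟨μ, fun f => div_nonneg (Finset.sum_nonneg fun lam _ => hW lam) hZ0.le, ?_, ?_, ?_⟩
  · have := hμ fun _ => True
    simpa [← hZ, hZ0.ne'] using this
  · intro f hf
    obtain ⟨lam, hlam, -⟩ := Finset.exists_ne_zero_of_sum_ne_zero (left_ne_zero_of_mul hf)
    obtain ⟨hg, rfl⟩ := Finset.mem_filter.1 hlam
    refine ⟨by simp [A], fun i v hv => ?_, fun i w hw => ?_⟩
    · simp only [A, Finset.mem_filter, Finset.mem_univ, true_and] at hv ⊢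
      exact (Fin.castSucc_lt_succ (i := i)).le.trans hv
    · have := (Finset.mem_filter.1 hg).2 i w hw
      simpa [bad] using this
  · intro m v x hv
    rw [hμ]
    rcases Nat.eq_zero_or_pos m with rfl | hm
    · simp [← hZ, hZ0.ne']
    have hprod : ∑ lam with ∀ i, v i ∈ A lam (x i), W lam = ∏ i, r ^ (x i : ℕ) := by
      let g : Fin n → Fin (N + 1) → ℝ := fun u j => if ∀ i, v i = u → x i ≤ j then 1 else 0
      have h1 := sum_prod_mul_prod q g
      have h2 : ∑ lam with ∀ i, v i ∈ A lam (x i), W lam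
          = ∑ lam : Fin n → Fin (N + 1), (∏ u, q (lam u)) * ∏ u, g u (lam u) := by
        rw [Finset.sum_filter]
        refine Finset.sum_congr rfl fun lam _ => ?_
        simp only [g, Finset.prod_boole, W, mul_ite, mul_one, mul_zero]
        refine if_congr ?_ rfl rfl
        simp only [A, Finset.mem_filter, Finset.mem_univ, true_and]
        exact ⟨fun h u _ i hi => hi ▸ h i, fun h i => h _ trivial i rfl⟩
      rw [h2, h1]
      symm
      refine Fintype.prod_of_injective v hv _ _ ?_ ?_
      · intro u hu
        have : ∀ i, v i ≠ u := fun i hi => hu ⟨i, hi⟩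
        simp [g, this, hq1]
      · intro i
        rw [← hqs, Finset.sum_filter]
        refine Finset.sum_congr rfl fun j _ => ?_
        simp [g, hv.eq_iff]
    have hpos : 0 ≤ ∏ i, r ^ (x i : ℕ) := Finset.prod_nonneg fun i _ => by positivity
    calc (∑ lam ∈ good with ∀ i, v i ∈ A lam (x i), W lam) / Z
        ≤ (∏ i, r ^ (x i : ℕ)) / (1 / 2) := by
          refine div_le_div₀ hpos ?_ (by norm_num) hgood
          rw [← hprod]
          exact Finset.sum_le_sum_of_subset_of_nonneg
            (Finset.filter_subset_filter _ (Finset.subset_univ _)) fun lam _ _ => hW lam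
      _ = 2 * ∏ i, r ^ (x i : ℕ) := by ring
      _ ≤ _ := by
          rw [Finset.prod_mul_distrib]
          gcongr
          simpa using le_self_pow₀ (by norm_num : (1 : ℝ) ≤ 2) hm.ne'

/-- Double counting: adding one vertex to `T` inside `A`. -/
theorem sum_hDegOn_insert {n : ℕ} {k : ℕ} (H : Finset (Finset (Fin n))) (hH : ∀ e ∈ H, e.card = k)
    (T A : Finset (Fin n)) :
    ∑ v ∈ A \ T, hDegOn H (insert v T) A = (k - T.card) * hDegOn H T A := by
  classical
  have h1 : ∀ v ∈ A \ T, hDegOn H (insert v T) A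
      = ∑ h ∈ H with T ⊆ h ∧ h \ T ⊆ A, if v ∈ h \ T then 1 else 0 := by
    intro v hv
    rw [Finset.mem_sdiff] at hv
    rw [hDegOn, Finset.card_filter, Finset.sum_filter]
    refine Finset.sum_congr rfl fun h _ => ?_
    rw [← ite_and]
    refine if_congr ⟨?_, ?_⟩ rfl rfl
    · rintro ⟨h2, h3⟩
      rw [Finset.insert_subset_iff] at h2
      refine ⟨⟨h2.2, fun u hu => ?_⟩, Finset.mem_sdiff.2 ⟨h2.1, hv.2⟩⟩
      by_cases huv : u = v
      · exact huv ▸ hv.1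
      · refine h3 ?_
        simp_all
    · rintro ⟨⟨h2, h3⟩, h4⟩
      refine ⟨Finset.insert_subset_iff.2 ⟨(Finset.mem_sdiff.1 h4).1, h2⟩, fun u hu => h3 ?_⟩
      simp_all
  rw [Finset.sum_congr rfl h1, Finset.sum_comm, hDegOn, mul_comm, ← smul_eq_mul,
    ← Finset.sum_const]
  refine Finset.sum_congr rfl fun h hh => ?_
  obtain ⟨hh, h2, h3⟩ := Finset.mem_filter.1 hh
  rw [← hH h hh, ← Finset.card_sdiff_of_subset h2, ← Finset.card_filter]
  congr 1
  ext u
  simp only [Finset.mem_filter, Finset.mem_sdiff]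
  constructor
  · exact fun hu => hu.2
  · exact fun hu => ⟨⟨h3 (Finset.mem_sdiff.2 hu), hu.2⟩, hu⟩

theorem hDegOn_univ {n : ℕ} (H : Finset (Finset (Fin n))) (S : Finset (Fin n)) :
    hDegOn H S Finset.univ = hDeg H S := by
  simp [hDegOn, hDeg]

theorem hDeg_le_pow {n k : ℕ} (H : Finset (Finset (Fin n))) (hH : ∀ e ∈ H, e.card = k)
    (S : Finset (Fin n)) : hDeg H S ≤ n ^ (k - S.card) := by
  classical
  calc hDeg H S ≤ (Finset.powersetCard (k - S.card) (Finset.univ : Finset (Fin n))).card := by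
        refine Finset.card_le_card_of_injOn (fun h => h \ S) ?_ ?_
        · intro h hh
          obtain ⟨hh, hS⟩ := Finset.mem_filter.1 hh
          simp [Finset.card_sdiff_of_subset hS, hH h hh]
        · intro h hh h' hh' heq
          have e1 := Finset.sdiff_union_of_subset (Finset.mem_filter.1 hh).2
          have e2 := Finset.sdiff_union_of_subset (Finset.mem_filter.1 hh').2
          rw [← e1, ← e2]
          exact congrArg (· ∪ S) heq
    _ ≤ n ^ (k - S.card) := by
        rw [Finset.card_powersetCard, Finset.card_univ, Fintype.card_fin]
        exact Nat.choose_le_pow _ _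

/-- The degrees of the one-vertex extensions of `T`, scaled to lie in `[0, 1]`. -/
noncomputable def extWeight {n : ℕ} (k : ℕ) (H : Finset (Finset (Fin n))) (T : Finset (Fin n))
    (v : Fin n) : ℝ :=
  if v ∈ T then 0 else (hDeg H (insert v T) : ℝ) / (n : ℝ) ^ (k - T.card - 1)

theorem extWeight_nonneg {n : ℕ} (k : ℕ) (H : Finset (Finset (Fin n))) (T : Finset (Fin n))
    (v : Fin n) : 0 ≤ extWeight k H T v := by
  unfold extWeight
  split_ifs <;> positivity

theorem extWeight_le_one {n k : ℕ} (H : Finset (Finset (Fin n))) (hH : ∀ e ∈ H, e.card = k)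
    (T : Finset (Fin n)) (v : Fin n) : extWeight k H T v ≤ 1 := by
  unfold extWeight
  split_ifs with hv
  · exact zero_le_one
  · refine div_le_one_of_le₀ ?_ (by positivity)
    have := hDeg_le_pow H hH (insert v T)
    rw [Finset.card_insert_of_notMem hv, ← Nat.sub_sub] at this
    exact_mod_cast this

theorem pow_mul_sum_extWeight {n k : ℕ} (hn : 0 < n) (H : Finset (Finset (Fin n)))
    (T A : Finset (Fin n)) :
    (n : ℝ) ^ (k - T.card - 1) * ∑ v ∈ A, extWeight k H T v
      = ∑ v ∈ A \ T, (hDeg H (insert v T) : ℝ) := by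
  have hn' : (n : ℝ) ^ (k - T.card - 1) ≠ 0 := by positivity
  rw [Finset.mul_sum, Finset.sdiff_eq_filter, Finset.sum_filter]
  refine Finset.sum_congr rfl fun v _ => ?_
  by_cases hv : v ∈ T
  · simp [extWeight, hv]
  · simp [extWeight, hv]
    field_simp

/-- If all extension weights are well distributed over `A`, then degrees into `A` are at least what
one expects of a random set of density `p`. -/
theorem hDegOn_lower_bound {n k : ℕ} (hn : 0 < n) (H : Finset (Finset (Fin n)))
    (hH : ∀ e ∈ H, e.card = k) (A : Finset (Fin n)) (p η : ℝ) (hp : 0 ≤ p) (hη : 0 ≤ η)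
    (hA : (A.card : ℝ) ≤ 2 * (p * n))
    (hT : ∀ T : Finset (Fin n), T.card < k →
      p * ∑ v, extWeight k H T v - η * (p * n) ≤ ∑ v ∈ A, extWeight k H T v) :
    ∀ (j : ℕ) (T : Finset (Fin n)), T.card + j = k →
      p ^ j * hDeg H T - (2 ^ j - 1) * η * (p * n) ^ j ≤ hDegOn H T A := by
  intro j
  induction j with
  | zero =>
    intro T hTk
    have : hDeg H T = hDegOn H T A := by
      unfold hDeg hDegOn
      congr 1
      refine Finset.filter_congr fun h hh => ⟨fun hs => ⟨hs, ?_⟩, fun hs => hs.1⟩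
      rw [Finset.eq_of_subset_of_card_le hs (by rw [hH h hh]; omega)]
      simp
    simp [this]
  | succ j ih =>
    intro T hTk
    have h1 : ∑ v ∈ A \ T, (hDegOn H (insert v T) A : ℝ) = (j + 1) * hDegOn H T A := by
      have := sum_hDegOn_insert H hH T A
      rw [show k - T.card = j + 1 by omega] at this
      exact_mod_cast this
    have h2 : ∑ v ∈ Finset.univ \ T, (hDeg H (insert v T) : ℝ) = (j + 1) * hDeg H T := by
      have := sum_hDegOn_insert H hH T Finset.univ
      simp only [hDegOn_univ] at this
      rw [show k - T.card = j + 1 by omega] at this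
      exact_mod_cast this
    have h3 : p * ((j + 1) * hDeg H T) - η * (p * n) * n ^ j
        ≤ ∑ v ∈ A \ T, (hDeg H (insert v T) : ℝ) := by
      have e1 := pow_mul_sum_extWeight (k := k) hn H T A
      have e2 := pow_mul_sum_extWeight (k := k) hn H T Finset.univ
      rw [show k - T.card - 1 = j by omega] at e1 e2
      rw [← e1, ← h2, ← e2]
      have := mul_le_mul_of_nonneg_left (hT T (by omega)) (by positivity : (0 : ℝ) ≤ (n : ℝ) ^ j)
      linarith
    have h4 : ∑ v ∈ A \ T, (p ^ j * hDeg H (insert v T) - (2 ^ j - 1) * η * (p * n) ^ j)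
        ≤ (j + 1) * hDegOn H T A := by
      rw [← h1]
      refine Finset.sum_le_sum fun v hv => ih (insert v T) ?_
      rw [Finset.card_insert_of_notMem (Finset.mem_sdiff.1 hv).2]
      omega
    rw [Finset.sum_sub_distrib, ← Finset.mul_sum, Finset.sum_const, nsmul_eq_mul] at h4
    have h5 : ((A \ T).card : ℝ) ≤ 2 * (p * n) :=
      le_trans (by exact_mod_cast Finset.card_le_card Finset.sdiff_subset) hA
    have h2j : (1 : ℝ) ≤ 2 ^ j := one_le_pow₀ (by norm_num)
    have hc : 0 ≤ ((2 : ℝ) ^ j - 1) * η * (p * n) ^ j := by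
      have : (0 : ℝ) ≤ 2 ^ j - 1 := by linarith
      positivity
    have h6 := mul_le_mul_of_nonneg_right h5 hc
    have h7 := mul_le_mul_of_nonneg_left h3 (pow_nonneg hp j)
    have hE : 0 ≤ (2 ^ (j + 1) - 1) * η * (p * n) ^ (j + 1) := by
      have : (1 : ℝ) ≤ 2 ^ (j + 1) := one_le_pow₀ (by norm_num)
      have : (0 : ℝ) ≤ 2 ^ (j + 1) - 1 := by linarith
      positivity
    have h8 : (j + 1 : ℝ) * (p ^ (j + 1) * hDeg H T) - (2 ^ (j + 1) - 1) * η * (p * n) ^ (j + 1)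
        ≤ (j + 1) * hDegOn H T A := by
      refine le_trans (le_of_eq ?_) (le_trans (add_le_add h7 (neg_le_neg h6)) (by linarith))
      ring
    have hj : (0 : ℝ) < j + 1 := by positivity
    refine le_of_mul_le_mul_left ?_ hj
    have : (2 ^ (j + 1) - 1) * η * (p * n) ^ (j + 1)
        ≤ (j + 1) * ((2 ^ (j + 1) - 1) * η * (p * n) ^ (j + 1)) :=
      le_mul_of_one_le_left hE (by linarith [Nat.cast_nonneg (α := ℝ) j])
    linarith

open Filter Topology in
theorem eventually_log_le_mul_rpow (c s : ℝ) (hc : 0 < c) (hs : 0 < s) :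
    ∀ᶠ n : ℕ in atTop, Real.log n ≤ c * (n : ℝ) ^ s := by
  have h := (isLittleO_log_rpow_atTop hs).bound hc
  filter_upwards [tendsto_natCast_atTop_atTop.eventually h] with n hn
  have : 0 ≤ (n : ℝ) ^ s := by positivity
  rw [Real.norm_of_nonneg this] at hn
  exact (le_abs_self _).trans hn

open Filter Topology in
theorem eventually_le_mul_rpow (c C s : ℝ) (hc : 0 < c) (hs : 0 < s) :
    ∀ᶠ n : ℕ in atTop, C ≤ c * (n : ℝ) ^ s :=
  (((tendsto_rpow_atTop hs).comp tendsto_natCast_atTop_atTop).const_mul_atTop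
    hc).eventually_ge_atTop C

open Filter Topology in
theorem eventually_mul_rpow_le_mul_rpow (c C s t : ℝ) (hc : 0 < c) (hst : s < t) :
    ∀ᶠ n : ℕ in atTop, C * (n : ℝ) ^ s ≤ c * (n : ℝ) ^ t := by
  filter_upwards [eventually_le_mul_rpow c C (t - s) hc (sub_pos.2 hst), eventually_gt_atTop 0]
    with n hn hn0
  have hn0 : (0 : ℝ) < n := by exact_mod_cast hn0
  calc C * (n : ℝ) ^ s ≤ c * (n : ℝ) ^ (t - s) * (n : ℝ) ^ s := by gcongr
    _ = c * (n : ℝ) ^ t := by rw [mul_assoc, ← Real.rpow_add hn0]; ring_nf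

open Filter Topology in
theorem tendsto_rpow_neg_natCast (s : ℝ) (hs : 0 < s) :
    Tendsto (fun n : ℕ => (n : ℝ) ^ (-s)) atTop (𝓝 0) :=
  (tendsto_rpow_neg_atTop hs).comp tendsto_natCast_atTop_atTop

open Filter Topology in
theorem eventually_log_sq_mul_rpow_neg_le (c s : ℝ) (hc : 0 < c) (hs : 0 < s) :
    ∀ᶠ n : ℕ in atTop, 4 * Real.log n ^ 2 * (n : ℝ) ^ (-s) ≤ c ^ 2 := by
  filter_upwards [eventually_log_le_mul_rpow (c / 2) (s / 2) (by positivity) (by positivity),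
    eventually_gt_atTop 0] with n hn hn0
  have hn1 : (1 : ℝ) ≤ n := by exact_mod_cast hn0
  have hn0 : (0 : ℝ) < n := by linarith
  have hlog := Real.log_nonneg hn1
  calc 4 * Real.log n ^ 2 * (n : ℝ) ^ (-s)
      ≤ 4 * (c / 2 * (n : ℝ) ^ (s / 2)) ^ 2 * (n : ℝ) ^ (-s) := by gcongr
    _ = c ^ 2 * ((n : ℝ) ^ (s / 2) * (n : ℝ) ^ (s / 2) * (n : ℝ) ^ (-s)) := by ring
    _ = c ^ 2 := by
      rw [← Real.rpow_add hn0, ← Real.rpow_add hn0]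
      ring_nf
      simp

open Filter Topology in
theorem eventually_log_mul_poly_mul_exp_le (k : ℕ) (s : ℝ) (hs : 0 < s) :
    ∀ᶠ n : ℕ in atTop,
      (Real.log n + 1) * ((2 + k * (n : ℝ) ^ k) * Real.exp (-((n : ℝ) ^ s / 2))) ≤ 1 / 2 := by
  filter_upwards [eventually_log_le_mul_rpow (1 / (2 * (k + 3))) s (by positivity) hs,
    eventually_ge_atTop (k + 2)] with n hn hnk
  have hnk : (k : ℝ) + 2 ≤ n := by exact_mod_cast hnk
  have hk0 : (0 : ℝ) ≤ k := by positivity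
  have hn0 : (0 : ℝ) < n := by linarith
  have hn1 : (1 : ℝ) ≤ n := by linarith
  have h1 : Real.log n + 1 ≤ n := by linarith [Real.log_le_sub_one_of_pos hn0]
  have h2 : 2 + k * (n : ℝ) ^ k ≤ (n : ℝ) ^ (k + 1) := by
    have : (1 : ℝ) ≤ (n : ℝ) ^ k := one_le_pow₀ hn1
    rw [pow_succ']
    nlinarith
  have h3 : Real.exp (-((n : ℝ) ^ s / 2)) ≤ ((n : ℝ) ^ (k + 3))⁻¹ := by
    have h4 : ((k + 3 : ℕ) : ℝ) * Real.log n ≤ (n : ℝ) ^ s / 2 := by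
      calc ((k + 3 : ℕ) : ℝ) * Real.log n
          ≤ ((k + 3 : ℕ) : ℝ) * (1 / (2 * (k + 3)) * (n : ℝ) ^ s) := by gcongr
        _ = _ := by push_cast; field_simp
    rw [Real.exp_neg]
    gcongr
    rw [← Real.log_le_iff_le_exp (by positivity), Real.log_pow]
    exact h4
  calc (Real.log n + 1) * ((2 + k * (n : ℝ) ^ k) * Real.exp (-((n : ℝ) ^ s / 2)))
      ≤ n * ((n : ℝ) ^ (k + 1) * ((n : ℝ) ^ (k + 3))⁻¹) := by gcongr
    _ = (n : ℝ)⁻¹ := by field_simp; ring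
    _ ≤ 1 / 2 := by
      rw [one_div]
      exact inv_anti₀ (by norm_num) (by linarith)

open Filter Topology in
theorem eventually_density_bound (d : ℕ) (α ε K s : ℝ) (hε : 0 < ε) (hs : 0 < s) :
    ∀ᶠ n : ℕ in atTop, (α + ε / 2) * (1 + (n : ℝ) ^ (-s)) ^ d + K * (n : ℝ) ^ (-s)
      ≤ (α + ε) * (1 - d / n) ^ d := by
  have h1 := tendsto_rpow_neg_natCast s hs
  have h2 : Tendsto (fun n : ℕ => (d : ℝ) / n) atTop (𝓝 0) :=
    tendsto_const_div_atTop_nhds_zero_nat _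
  have h3 := ((((h1.const_add 1).pow d).const_mul (α + ε / 2)).add (h1.const_mul K))
  have h4 := (((h2.const_sub 1).pow d).const_mul (α + ε))
  refine (h3.eventually_lt h4 ?_).mono fun n hn => hn.le
  simp
  linarith

theorem exists_pow_mul_mem_window (r n a b : ℝ) (hr : 0 < r) (hr1 : r < 1) (ha : 0 < a)
    (han : a ≤ n) (hab : a ≤ r * b) : ∃ N : ℕ, a ≤ r ^ N * n ∧ r ^ N * n ≤ b := by
  classical
  have hn : 0 < n := ha.trans_le han
  have hex : ∃ N : ℕ, r ^ (N + 1) * n < a := by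
    obtain ⟨N, hN⟩ := exists_pow_lt_of_lt_one (div_pos ha hn) hr1
    refine ⟨N, ?_⟩
    rw [lt_div_iff₀ hn] at hN
    refine lt_of_le_of_lt ?_ hN
    gcongr ?_ * _
    exact pow_le_pow_of_le_one hr.le hr1.le (Nat.le_succ N)
  refine ⟨Nat.find hex, ?_, ?_⟩
  · rcases h : Nat.find hex with _ | M
    · simpa using han
    · exact not_lt.1 (Nat.find_min hex (m := M) (by omega))
  · have := Nat.find_spec hex
    rw [pow_succ] at this
    refine le_of_mul_le_mul_left ?_ hr
    linarith

theorem natCast_le_log_of_one_le_pow_mul (r n : ℝ) (N : ℕ) (hr : 0 < r) (hr1 : r ≤ 1 / 3)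
    (hn : 0 < n) (h : 1 ≤ r ^ N * n) : (N : ℝ) ≤ Real.log n := by
  have h1 : Real.log (r ^ N * n) = N * Real.log r + Real.log n := by
    rw [Real.log_mul (by positivity) hn.ne', Real.log_pow]
  have h2 := Real.log_nonneg h
  have h3 : Real.log r ≤ -1 := by
    rw [Real.log_le_iff_le_exp hr, Real.exp_neg]
    have := Real.exp_one_lt_d9
    calc r ≤ 1 / 3 := hr1
      _ ≤ (Real.exp 1)⁻¹ := by
        rw [one_div]
        exact inv_anti₀ (Real.exp_pos 1) (by linarith)
  have : (0 : ℝ) ≤ N := by positivity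
  nlinarith

/-- Passing from a lower bound on the number of edges inside `A` to the density of those edges. -/
theorem mul_choose_le_of_lower_bound (d n a : ℕ) (α ε p η x y : ℝ) (hα : 0 < α) (hε : 0 < ε)
    (hn : 0 < n) (hdn : d ≤ n) (hp : 0 ≤ p) (hη : 0 ≤ η)
    (hx : (α + ε) * (n.choose d : ℝ) ≤ x) (hy : p ^ d * x - (2 ^ d - 1) * η * (p * n) ^ d ≤ y)
    (ha : (a : ℝ) ≤ (1 + η) * (p * n))
    (hη' : (α + ε / 2) * (1 + η) ^ d + (2 ^ d * d.factorial) * η ≤ (α + ε) * (1 - d / n) ^ d) :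
    (α + ε / 2) * (a.choose d : ℝ) ≤ y := by
  have hf : (0 : ℝ) < d.factorial := by positivity
  have hn0 : (0 : ℝ) < n := by exact_mod_cast hn
  have h1 : (d.factorial : ℝ) * a.choose d ≤ (1 + η) ^ d * (p * n) ^ d := by
    rw [← mul_pow]
    calc (d.factorial : ℝ) * a.choose d = (a.descFactorial d : ℝ) := by
          rw [Nat.descFactorial_eq_factorial_mul_choose]; push_cast; rfl
      _ ≤ (a : ℝ) ^ d := by exact_mod_cast Nat.descFactorial_le_pow a d
      _ ≤ _ := by gcongr
  have h2 : (1 - d / n : ℝ) ^ d * (n : ℝ) ^ d ≤ d.factorial * n.choose d := by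
    rw [← mul_pow]
    calc ((1 - d / n : ℝ) * n) ^ d = (((n - d : ℕ) : ℝ)) ^ d := by
          rw [Nat.cast_sub hdn]; congr 1; field_simp
      _ ≤ (((n + 1 - d : ℕ) : ℝ)) ^ d := by
          gcongr
          exact Nat.le_succ n
      _ ≤ (n.descFactorial d : ℝ) := by exact_mod_cast Nat.pow_sub_le_descFactorial n d
      _ = _ := by rw [Nat.descFactorial_eq_factorial_mul_choose]; push_cast; rfl
  have hpn : 0 ≤ (p * n) ^ d := by positivity
  refine le_of_mul_le_mul_left ?_ hf
  calc d.factorial * ((α + ε / 2) * (a.choose d : ℝ))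
      = (α + ε / 2) * (d.factorial * a.choose d) := by ring
    _ ≤ (α + ε / 2) * ((1 + η) ^ d * (p * n) ^ d) := by gcongr
    _ ≤ ((α + ε) * (1 - d / n) ^ d - (2 ^ d * d.factorial) * η) * (p * n) ^ d := by
        rw [← mul_assoc]
        gcongr
        linarith
    _ = p ^ d * ((α + ε) * ((1 - d / n) ^ d * (n : ℝ) ^ d))
          - d.factorial * (2 ^ d * η * (p * n) ^ d) := by
        rw [mul_pow]; ring
    _ ≤ p ^ d * ((α + ε) * (d.factorial * n.choose d))
          - d.factorial * (2 ^ d * η * (p * n) ^ d) := by gcongr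
    _ = d.factorial * (p ^ d * ((α + ε) * n.choose d) - 2 ^ d * η * (p * n) ^ d) := by ring
    _ ≤ d.factorial * (p ^ d * x - (2 ^ d - 1) * η * (p * n) ^ d) := by
        gcongr
        linarith
    _ ≤ d.factorial * y := by gcongr

theorem exists_extWeight_family {n k : ℕ} (hn : 0 < n) (H : Finset (Finset (Fin n)))
    (hH : ∀ e ∈ H, e.card = k) :
    ∃ F : Finset (Fin n → ℝ), F.card ≤ 2 + k * n ^ k ∧ (∀ w ∈ F, ∀ v, |w v| ≤ 1) ∧
      (fun _ => 1) ∈ F ∧ (fun _ => -1) ∈ F ∧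
      ∀ T : Finset (Fin n), T.card < k → (fun v => -extWeight k H T v) ∈ F := by
  classical
  let U := (Finset.range k).biUnion fun j => Finset.powersetCard j (Finset.univ : Finset (Fin n))
  have hU : U.card ≤ k * n ^ k := by
    refine (Finset.card_biUnion_le_card_mul _ _ (n ^ k) fun j hj => ?_).trans (by simp)
    rw [Finset.card_powersetCard, Finset.card_univ, Fintype.card_fin]
    exact (Nat.choose_le_pow _ _).trans (Nat.pow_le_pow_right hn (Finset.mem_range.1 hj).le)
  refine ⟨insert (fun _ => 1) (insert (fun _ => -1) (U.image fun T v => -extWeight k H T v)),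
    ?_, ?_, by simp, by simp, fun T hT => ?_⟩
  · have h1 := Finset.card_image_le (s := U) (f := fun T v => -extWeight k H T v)
    have h2 := Finset.card_insert_le (fun _ => -1) (U.image fun T v => -extWeight k H T v)
    refine (Finset.card_insert_le _ _).trans ?_
    omega
  · intro w hw v
    simp only [Finset.mem_insert, Finset.mem_image] at hw
    rcases hw with rfl | rfl | ⟨T, -, rfl⟩
    · simp
    · simp
    · rw [abs_neg, abs_of_nonneg (extWeight_nonneg k H T v)]
      exact extWeight_le_one H hH T v
  · refine Finset.mem_insert_of_mem (Finset.mem_insert_of_mem (Finset.mem_image_of_mem _ ?_))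
    simpa [U] using hT

theorem abs_sub_mul_le_of_window {r η c P x y : ℝ} (hr : 0 ≤ r) (hP : 0 ≤ P) (hη : 0 ≤ η)
    (hη1 : η ≤ 1 / 2) (hc : 4 * η ≤ c) (hy : y ≤ (1 + η) * (r * P)) (hy' : (1 - η) * (r * P) ≤ y)
    (hx : x ≤ (1 + η) * P) (hx' : (1 - η) * P ≤ x) : |y - r * x| ≤ c * r * x := by
  have hhalf : P / 2 ≤ x := by nlinarith
  have hc0 : 0 ≤ c := by linarith
  have hrhs : 2 * η * (r * P) ≤ c * r * x := by
    calc 2 * η * (r * P) = 4 * η * r * (P / 2) := by ring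
      _ ≤ _ := by gcongr
  have h1 := mul_le_mul_of_nonneg_left hx hr
  have h2 := mul_le_mul_of_nonneg_left hx' hr
  refine le_trans (abs_le.2 ⟨?_, ?_⟩) hrhs <;> linarith

/-- Vortex lemma: a random sequence of nested vertex sets with controlled sizes, inherited
minimum degree, and a product-type probability bound for membership of prescribed vertices in
prescribed levels. -/
theorem statement7 :
    ∀ k l : ℕ, 1 ≤ l → l < k → ∀ α : ℝ, 0 < α → ∀ ε : ℝ, 0 < ε → ε < 1 / 10 →
    ∃ C : ℕ, 0 < C ∧ ∀ n : ℕ, C ≤ n →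
    ∀ H : Finset (Finset (Fin n)), (∀ e ∈ H, e.card = k) →
    (∀ S : Finset (Fin n), S.card = l →
      (α + ε) * (n.choose (k - l) : ℝ) ≤ (hDeg H S : ℝ)) →
    ∃ (N : ℕ) (μ : (Fin (N + 1) → Finset (Fin n)) → ℝ),
      (∀ f, 0 ≤ μ f) ∧ (∑ f : Fin (N + 1) → Finset (Fin n), μ f = 1) ∧
      (∀ f : Fin (N + 1) → Finset (Fin n), μ f ≠ 0 →
        -- the support consists of decreasing sequences starting at `V(𝓗)`
        f 0 = Finset.univ ∧ (∀ i : Fin N, f i.succ ⊆ f i.castSucc) ∧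
        -- (V1)
        (∀ i : Fin N,
          |((f i.succ).card : ℝ) - ε ^ 2 * ((f i.castSucc).card : ℝ)| ≤
            (ε ^ 2 / (N : ℝ) ^ 2) * ε ^ 2 * ((f i.castSucc).card : ℝ)) ∧
        -- (V2)
        ((n : ℝ) ^ ((1 : ℝ) / (k + 2)) ≤ ((f (Fin.last N)).card : ℝ) ∧
          ((f (Fin.last N)).card : ℝ) ≤ (n : ℝ) ^ ((1 : ℝ) / (k + 1))) ∧
        -- (V3)
        (∀ S : Finset (Fin n), S.card = l → ∀ i : Fin (N + 1),
          (α + ε / 2) * (((f i).card.choose (k - l)) : ℝ) ≤ (hDegOn H S (f i) : ℝ))) ∧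
      -- (V4)
      (∀ (m : ℕ) (v : Fin m → Fin n) (x : Fin m → Fin (N + 1)), Function.Injective v →
        ∑ f ∈ Finset.univ.filter
            (fun f : Fin (N + 1) → Finset (Fin n) => ∀ i, v i ∈ f (x i)), μ f ≤
          ∏ i : Fin m, 2 * ε ^ (2 * (x i : ℕ))) := by
  intro k l hl hlk α hα ε hε hε1
  set δ : ℝ := (1 : ℝ) / (k + 2) with hδ
  set κ : ℝ := (1 : ℝ) / (k + 1) with hκ
  have hδ0 : 0 < δ := by positivity
  have hδκ : δ < κ := by rw [hδ, hκ]; gcongr; linarith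
  have hκ1 : κ ≤ 1 := by rw [hκ]; exact div_le_one_of_le₀ (by linarith) (by positivity)
  have hr : 0 < ε ^ 2 := by positivity
  have hr1 : ε ^ 2 ≤ 1 / 3 := by nlinarith
  obtain ⟨C, hC⟩ := Filter.eventually_atTop.1
    ((((eventually_mul_rpow_le_mul_rpow (ε ^ 2) 4 δ κ hr hδκ).and
      (eventually_mul_rpow_le_mul_rpow 1 2 δ 1 one_pos (hδκ.trans_le hκ1))).and
      ((eventually_log_sq_mul_rpow_neg_le ε (δ / 4) hε (by positivity)).and
      ((tendsto_rpow_neg_natCast (δ / 4) (by positivity)).eventually_le_const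
        (by norm_num : (0 : ℝ) < 1 / 2)))).and
      ((eventually_density_bound (k - l) α ε (2 ^ (k - l) * (k - l).factorial) (δ / 4) hε
        (by positivity)).and
      (eventually_log_mul_poly_mul_exp_le k (δ / 2) (by positivity))))
  refine ⟨C + k + 1, by omega, fun n hn H hH hdeg => ?_⟩
  obtain ⟨⟨⟨hwin, hbig⟩, hlog, hηhalf⟩, hdens, hprob⟩ := hC n (by omega)
  set η : ℝ := (n : ℝ) ^ (-(δ / 4)) with hη
  have hnpos : 0 < n := by omega
  have hn0 : (0 : ℝ) < n := by exact_mod_cast hnpos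
  have hn1 : (1 : ℝ) ≤ n := by exact_mod_cast hnpos
  have hη0 : 0 < η := by positivity
  have hnδ : 1 ≤ (n : ℝ) ^ δ := Real.one_le_rpow hn1 hδ0.le
  obtain ⟨N, hNl, hNu⟩ := exists_pow_mul_mem_window (ε ^ 2) n (2 * (n : ℝ) ^ δ) ((n : ℝ) ^ κ / 2) hr
    (by linarith) (by linarith) (by simpa using hbig) (by linarith)
  have hNlog : (N : ℝ) ≤ Real.log n :=
    natCast_le_log_of_one_le_pow_mul (ε ^ 2) n N hr hr1 hn0 (by linarith)
  obtain ⟨F, hFcard, hFle, hF1, hF1', hFT⟩ := exists_extWeight_family hnpos H hH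
  have hexp : (n : ℝ) ^ (δ / 2) / 2 ≤ η ^ 2 * ((ε ^ 2) ^ N * n) / 4 := by
    calc (n : ℝ) ^ (δ / 2) / 2 = η ^ 2 * (2 * (n : ℝ) ^ δ) / 4 := by
          have : (n : ℝ) ^ (δ / 2) = η ^ 2 * (n : ℝ) ^ δ := by
            rw [hη, pow_two, ← Real.rpow_add hn0, ← Real.rpow_add hn0]
            ring_nf
          rw [this]; ring
      _ ≤ _ := by gcongr
  have hlog0 : 0 ≤ Real.log n := Real.log_nonneg hn1
  obtain ⟨μ, hμ0, hμ1, hsupp, hspread⟩ := exists_nested_distribution n N (ε ^ 2) η hr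
    (by linarith) hη0 (by linarith) F hFle <| by
      refine le_trans ?_ hprob
      have : (F.card : ℝ) ≤ 2 + k * (n : ℝ) ^ k := by exact_mod_cast hFcard
      gcongr
  refine ⟨N, μ, hμ0, hμ1, fun f hf => ?_, fun m v x hv => ?_⟩
  · obtain ⟨h0, hdec, hw⟩ := hsupp f hf
    have hup : ∀ i : Fin (N + 1), ((f i).card : ℝ) ≤ (1 + η) * ((ε ^ 2) ^ (i : ℕ) * n) := by
      intro i
      have := hw i _ hF1
      simp at this
      linarith
    have hlo : ∀ i : Fin (N + 1), (1 - η) * ((ε ^ 2) ^ (i : ℕ) * n) ≤ ((f i).card : ℝ) := by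
      intro i
      have := hw i _ hF1'
      simp at this
      linarith
    have hpn : ∀ i : Fin (N + 1), 0 ≤ (ε ^ 2) ^ (i : ℕ) * (n : ℝ) := fun i => by positivity
    refine ⟨h0, hdec, fun i => ?_, ⟨?_, ?_⟩, fun S hS i => ?_⟩
    · have hN0 : (0 : ℝ) < N := by exact_mod_cast i.pos
      have u1 := hup i.succ
      have l1 := hlo i.succ
      have u2 := hup i.castSucc
      have l2 := hlo i.castSucc
      have hP := hpn i.castSucc
      rw [Fin.val_succ, pow_succ] at u1 l1
      rw [Fin.val_castSucc] at u2 l2 hP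
      set P := (ε ^ 2) ^ (i : ℕ) * (n : ℝ)
      have hηN : 4 * η ≤ ε ^ 2 / (N : ℝ) ^ 2 := by
        rw [le_div_iff₀ (by positivity)]
        calc 4 * η * (N : ℝ) ^ 2 ≤ 4 * η * Real.log n ^ 2 := by gcongr
          _ ≤ ε ^ 2 := by linarith
      rw [show (ε ^ 2) ^ (i : ℕ) * ε ^ 2 * (n : ℝ) = ε ^ 2 * P by ring] at u1 l1
      exact abs_sub_mul_le_of_window hr.le hP hη0.le hηhalf hηN u1 l1 u2 l2
    · have h1 := hlo (Fin.last N)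
      rw [Fin.val_last] at h1
      have h2 : 1 / 2 * (2 * (n : ℝ) ^ δ) ≤ (1 - η) * ((ε ^ 2) ^ N * n) := by
        gcongr <;> linarith
      linarith
    · have h1 := hup (Fin.last N)
      rw [Fin.val_last] at h1
      have h2 : (1 + η) * ((ε ^ 2) ^ N * n) ≤ 2 * ((n : ℝ) ^ κ / 2) := by
        gcongr
        linarith
      linarith
    · have hdegOn := hDegOn_lower_bound hnpos H hH (f i) ((ε ^ 2) ^ (i : ℕ)) η (by positivity) hη0.le
        ((hup i).trans (mul_le_mul_of_nonneg_right (by linarith) (hpn i)))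
        (fun T hT => by
          have := hw i _ (hFT T hT)
          simp only [Finset.sum_neg_distrib] at this
          linarith) (k - l) S (by omega)
      exact mul_choose_le_of_lower_bound (k - l) n (f i).card α ε _ η _ _ hα hε hnpos (by omega)
        (by positivity) hη0.le (hdeg S hS) hdegOn (hup i) hdens
  · simpa only [pow_mul] using hspread m v x hv
end

section
/- For all integers 1 ≤ ℓ < k and all ε, γ > 0 there exist γ' > 0 and n₀ = n₀(ε,γ,k,ℓ) such that the following holds. If 𝓗 is a k-uniform hypergraph on n ≥ n₀ vertices with δ_ℓ(𝓗) ≥ (δ⁺_{ℓ,k} + ε)·binom(n, k−ℓ), then 𝓗 contains a subhypergraph 𝓗' with at least γ'·binom(n,k) hyperedges in which every vertex lies in at most (1+γ)·γ'·binom(n,k−1) hyperedges. -/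
open Finset

/-- A matching `M` of the hypergraph `H` (on vertex set `Fin n`) which is perfect. -/
def HyperPM {n : ℕ} (H M : Finset (Finset (Fin n))) : Prop :=
  M ⊆ H ∧ (M : Set (Finset (Fin n))).PairwiseDisjoint id ∧ M.biUnion id = Finset.univ

/-- `t(n,k,ℓ)`: the smallest `d` such that every `n`-vertex `k`-uniform hypergraph with
minimum `ℓ`-degree at least `d` contains a perfect matching. -/
noncomputable def diracT (n k l : ℕ) : ℕ :=
  sInf {d : ℕ | ∀ H : Finset (Finset (Fin n)), (∀ e ∈ H, e.card = k) →
    (∀ S : Finset (Fin n), S.card = l → d ≤ hDeg H S) → ∃ M, HyperPM H M}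

/-- The `ℓ`-degree Dirac threshold `δ⁺_{ℓ,k} = lim_{n → ∞, k ∣ n} t(n,k,ℓ)/C(n,k-ℓ)`
(the limit is known to exist, so it equals the limsup along that filter). -/
noncomputable def diracThreshold (k l : ℕ) : ℝ :=
  Filter.limsup (fun n : ℕ => (diracT n k l : ℝ) / (n.choose (k - l)))
    (Filter.atTop ⊓ Filter.principal {n | k ∣ n})

/-- Hoeffding's lemma for the uniform distribution on a finite type. -/
theorem sum_exp_le_card_mul_exp {α : Type*} [Fintype α] (Y : α → ℝ) (c : ℝ)
    (hY : ∀ a, |Y a| ≤ c) (hsum : ∑ a, Y a = 0) :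
    ∑ a, Real.exp (Y a) ≤ Fintype.card α * Real.exp (c ^ 2 / 2) := by
  have key : ∀ a, Real.exp (Y a) ≤ Real.cosh c + Y a * (Real.sinh c / c) := by
    intro a
    have h1 := abs_le.1 (hY a)
    rcases (le_trans (abs_nonneg _) (hY a)).eq_or_lt with hc | hc
    · have : Y a = 0 := by subst hc; linarith
      simp [this, ← hc]
    · have := convexOn_exp.2 (Set.mem_univ (-c)) (Set.mem_univ c)
        (show 0 ≤ (c - Y a) / (2 * c) from div_nonneg (by linarith) (by linarith))
        (show 0 ≤ (c + Y a) / (2 * c) from div_nonneg (by linarith) (by linarith))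
        (by field_simp; ring)
      simp only [smul_eq_mul] at this
      rw [show (c - Y a) / (2 * c) * -c + (c + Y a) / (2 * c) * c = Y a by field_simp; ring] at this
      refine this.trans (le_of_eq ?_)
      rw [Real.cosh_eq, Real.sinh_eq]
      field_simp
      ring
  calc ∑ a, Real.exp (Y a) ≤ ∑ a, (Real.cosh c + Y a * (Real.sinh c / c)) :=
        sum_le_sum fun a _ => key a
    _ = Fintype.card α * Real.cosh c := by
        rw [sum_add_distrib, ← sum_mul, hsum]; simp
    _ ≤ _ := by gcongr; exact Real.cosh_le_exp_half_sq c

/-- Exponential moment bound for functions with bounded differences (McDiarmid). -/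
theorem sum_exp_le_of_bounded_differences {α : Type*} [Fintype α] [Nonempty α] {m : ℕ} (c : ℝ)
    (g : (Fin m → α) → ℝ)
    (hg : ∀ f i a, |g (Function.update f i a) - g f| ≤ c) :
    ∑ f, Real.exp (g f) ≤ (Fintype.card α : ℝ) ^ m *
      Real.exp ((∑ f, g f) / (Fintype.card α : ℝ) ^ m + m * (c ^ 2 / 2)) := by
  induction m with
  | zero => simp
  | succ m ih =>
    have hsplit : ∀ F : (Fin (m + 1) → α) → ℝ,
        ∑ f, F f = ∑ a : α, ∑ f : Fin m → α, F (Fin.cons a f) := by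
      intro F
      rw [← (Fin.consEquiv (fun _ : Fin (m + 1) => α)).sum_comp, Fintype.sum_prod_type]
      rfl
    set N : ℝ := (Fintype.card α : ℝ) with hN
    have hNpos : 0 < N := by rw [hN]; exact_mod_cast Fintype.card_pos
    set μ : α → ℝ := fun a => (∑ f : Fin m → α, g (Fin.cons a f)) / N ^ m with hμ
    have hdiff : ∀ a b, μ a - μ b ≤ c := by
      intro a b
      rw [hμ]
      simp only
      rw [← sub_div, ← sum_sub_distrib, div_le_iff₀ (by positivity)]
      calc _ ≤ ∑ f : Fin m → α, c := by
            refine sum_le_sum fun f _ => ?_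
            have := hg (Fin.cons b f) 0 a
            rw [Fin.update_cons_zero] at this
            exact (abs_le.1 this).2
        _ = _ := by simp [hN, mul_comm]
    set μ₀ : ℝ := (∑ a, μ a) / N with hμ₀
    have hmean : ∑ a, μ a = N * μ₀ := by rw [hμ₀]; field_simp
    have hdev : ∀ a, |μ a - μ₀| ≤ c := by
      intro a
      have h1 : N * (μ a - μ₀) ≤ N * c := by
        have : ∑ b, (μ a - μ b) ≤ ∑ _b : α, c := sum_le_sum fun b _ => hdiff a b
        simp only [sum_sub_distrib, sum_const, card_univ, nsmul_eq_mul, hmean, ← hN] at this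
        linarith
      have h2 : N * (μ₀ - μ a) ≤ N * c := by
        have : ∑ b, (μ b - μ a) ≤ ∑ _b : α, c := sum_le_sum fun b _ => hdiff b a
        simp only [sum_sub_distrib, sum_const, card_univ, nsmul_eq_mul, hmean, ← hN] at this
        linarith
      rw [abs_le]
      constructor <;> nlinarith
    have htot : (∑ f, g f) / N ^ (m + 1) = μ₀ := by
      rw [hsplit, hμ₀, hμ]
      simp only
      rw [← sum_div, div_div, pow_succ]
    rw [htot, hsplit]
    calc ∑ a, ∑ f : Fin m → α, Real.exp (g (Fin.cons a f))
        ≤ ∑ a, N ^ m * Real.exp (μ a + m * (c ^ 2 / 2)) := by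
          refine sum_le_sum fun a _ => ih _ fun f i b => ?_
          rw [Fin.cons_update]
          exact hg _ _ _
      _ = N ^ m * Real.exp (μ₀ + m * (c ^ 2 / 2)) * ∑ a, Real.exp (μ a - μ₀) := by
          rw [mul_sum]
          refine sum_congr rfl fun a _ => ?_
          rw [mul_assoc, ← Real.exp_add]
          ring_nf
      _ ≤ N ^ m * Real.exp (μ₀ + m * (c ^ 2 / 2)) * (N * Real.exp (c ^ 2 / 2)) := by
          gcongr
          refine sum_exp_le_card_mul_exp _ c hdev ?_
          rw [sum_sub_distrib, hmean]
          simp [hN]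
      _ = _ := by
          rw [pow_succ, mul_mul_mul_comm, ← Real.exp_add]
          push_cast
          ring_nf

/-- McDiarmid's inequality (lower tail) for uniformly random functions. -/
theorem card_filter_le_of_bounded_differences {α : Type*} [Fintype α] [Nonempty α] {m : ℕ}
    (hm : 0 < m) (c t b : ℝ) (hc : 0 < c) (ht : 0 ≤ t) (g : (Fin m → α) → ℝ)
    (hg : ∀ f i a, |g (Function.update f i a) - g f| ≤ c)
    (hb : (b + t) * (Fintype.card α : ℝ) ^ m ≤ ∑ f, g f) :
    ((univ.filter fun f => g f < b).card : ℝ) ≤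
      (Fintype.card α : ℝ) ^ m * Real.exp (-(t ^ 2 / (2 * m * c ^ 2))) := by
  set N : ℝ := (Fintype.card α : ℝ) ^ m with hN
  have hNpos : 0 < N := by
    have : (0 : ℝ) < Fintype.card α := by exact_mod_cast Fintype.card_pos
    positivity
  have hm' : (0 : ℝ) < m := by exact_mod_cast hm
  set s : ℝ := t / (m * c ^ 2) with hs
  have hs0 : 0 ≤ s := by positivity
  have h1 := sum_exp_le_of_bounded_differences (s * c) (fun f => -s * g f) (by
    intro f i a
    rw [← mul_sub, abs_mul, abs_neg, abs_of_nonneg hs0]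
    exact mul_le_mul_of_nonneg_left (hg f i a) hs0)
  rw [← hN, ← mul_sum] at h1
  have h2 : ((univ.filter fun f => g f < b).card : ℝ) * Real.exp (-s * b) ≤
      ∑ f, Real.exp (-s * g f) := by
    rw [← nsmul_eq_mul, ← sum_const]
    refine (sum_le_sum fun f hf => ?_).trans
      (sum_le_sum_of_subset_of_nonneg (filter_subset _ _) fun _ _ _ => (Real.exp_pos _).le)
    rw [mem_filter] at hf
    apply Real.exp_le_exp.2
    nlinarith [hf.2]
  have h3 : -s * (∑ f, g f) / N ≤ -s * (b + t) := by
    rw [div_le_iff₀ hNpos]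
    nlinarith
  have h4 := h2.trans h1
  rw [← le_div_iff₀ (Real.exp_pos _), mul_div_assoc, ← Real.exp_sub] at h4
  refine h4.trans ?_
  gcongr
  have : m * ((s * c) ^ 2 / 2) - s * t = -(t ^ 2 / (2 * m * c ^ 2)) := by
    rw [hs]; field_simp; ring
  linarith

/-- Rounding a fractional point of a box without changing `V` linear functionals leaves at most
`card V` fractional coordinates. -/
theorem exists_few_fractional {β V : Type*} [Fintype β] [DecidableEq β] [Fintype V]
    (a : β → V → ℝ) (w : β → ℝ) (hw : ∀ e, w e ∈ Set.Icc (0 : ℝ) 1) :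
    ∃ w' : β → ℝ, (∀ e, w' e ∈ Set.Icc (0 : ℝ) 1) ∧ (∀ e, w e = 0 → w' e = 0) ∧
      (∀ v, ∑ e, w' e * a e v = ∑ e, w e * a e v) ∧ ∑ e, w e ≤ ∑ e, w' e ∧
      (univ.filter fun e => w' e ∈ Set.Ioo (0 : ℝ) 1).card ≤ Fintype.card V := by
  classical
  induction hF : (univ.filter fun e => w e ∈ Set.Ioo (0 : ℝ) 1).card
    using Nat.strong_induction_on generalizing w with
  | _ d ih =>
  subst hF
  by_cases hd : (univ.filter fun e => w e ∈ Set.Ioo (0 : ℝ) 1).card ≤ Fintype.card V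
  · exact ⟨w, hw, fun _ h => h, fun _ => rfl, le_rfl, hd⟩
  push Not at hd
  set F := univ.filter fun e => w e ∈ Set.Ioo (0 : ℝ) 1 with hFdef
  obtain ⟨u, hu0, huF, hua, hus⟩ : ∃ u : β → ℝ, (∃ e, u e ≠ 0) ∧ (∀ e, e ∉ F → u e = 0) ∧
      (∀ v, ∑ e, u e * a e v = 0) ∧ 0 ≤ ∑ e, u e := by
    obtain ⟨u, hu0, huF, hua⟩ : ∃ u : β → ℝ, (∃ e, u e ≠ 0) ∧ (∀ e, e ∉ F → u e = 0) ∧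
        (∀ v, ∑ e, u e * a e v = 0) := by
      let T : (F → ℝ) →ₗ[ℝ] (V → ℝ) := Fintype.linearCombination ℝ (fun e : F => a e)
      have hT : LinearMap.ker T ≠ ⊥ := by
        apply LinearMap.ker_ne_bot_of_finrank_lt
        simpa using hd
      obtain ⟨x, hx, hx0⟩ := (Submodule.ne_bot_iff _).1 hT
      obtain ⟨e, he⟩ := Function.ne_iff.1 hx0
      refine ⟨fun e => if h : e ∈ F then x ⟨e, h⟩ else 0, ⟨e, by simpa using he⟩,
        fun e he => dif_neg he, fun v => ?_⟩
      have hx' := congrFun (LinearMap.mem_ker.1 hx) v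
      simp only [T, Fintype.linearCombination_apply, Finset.sum_apply, Pi.smul_apply,
        smul_eq_mul, Pi.zero_apply] at hx'
      refine Eq.trans ?_ hx'
      rw [← sum_subset (subset_univ F) (by intro e _ he; simp [he]), ← sum_coe_sort F]
      simp
    rcases le_total 0 (∑ e, u e) with h | h
    · exact ⟨u, hu0, huF, hua, h⟩
    · refine ⟨-u, ?_, ?_, ?_, ?_⟩
      · simpa using hu0
      · intro e he; simp [huF e he]
      · intro v; simp [hua v]
      · simpa using h
  have hmemF : ∀ e, u e ≠ 0 → 0 < w e ∧ w e < 1 := by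
    intro e he
    have : e ∈ F := by by_contra h; exact he (huF e h)
    simpa [hFdef] using this
  obtain ⟨e₀, he₀, hmin⟩ := (univ.filter fun e => u e ≠ 0).exists_min_image
    (fun e => if 0 < u e then (1 - w e) / u e else - w e / u e)
    (by obtain ⟨e, he⟩ := hu0; exact ⟨e, by simpa using he⟩)
  simp only [mem_filter, mem_univ, true_and] at he₀ hmin
  set t := if 0 < u e₀ then (1 - w e₀) / u e₀ else - w e₀ / u e₀ with ht
  have ht0 : 0 ≤ t := by
    have := hmemF e₀ he₀
    rw [ht]
    split_ifs with h
    · exact div_nonneg (by linarith) h.le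
    · exact div_nonneg_of_nonpos (by linarith) (by linarith)
  have hbox : ∀ e, w e + t * u e ∈ Set.Icc (0 : ℝ) 1 := by
    intro e
    by_cases hue : u e = 0
    · simpa [hue] using hw e
    have h1 := hmin e hue
    have h2 := hmemF e hue
    split_ifs at h1 with h
    · rw [le_div_iff₀ h] at h1
      exact ⟨by nlinarith, by linarith⟩
    · have h : u e < 0 := lt_of_le_of_ne (not_lt.1 h) hue
      rw [le_div_iff_of_neg h] at h1
      exact ⟨by linarith, by nlinarith⟩
  have he₀' : w e₀ + t * u e₀ = 0 ∨ w e₀ + t * u e₀ = 1 := by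
    rw [ht]
    split_ifs with h
    · right; field_simp; ring
    · left; field_simp; ring
  obtain ⟨w', h1, h2, h3, h4, h5⟩ := ih
    (univ.filter fun e => w e + t * u e ∈ Set.Ioo (0 : ℝ) 1).card (by
      apply card_lt_card
      refine (ssubset_iff_of_subset ?_).2 ⟨e₀, ?_, ?_⟩
      · intro e he
        by_cases hue : u e = 0
        · simpa [hFdef, hue] using he
        · simpa [hFdef] using hmemF e hue
      · simpa [hFdef] using hmemF e₀ he₀
      · rcases he₀' with h | h <;> simp [h]) (fun e => w e + t * u e) hbox rfl
  refine ⟨w', h1, fun e he => h2 e ?_, fun v => ?_, ?_, h5⟩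
  · by_cases hue : u e = 0
    · simp [hue, he]
    · exact absurd he (hmemF e hue).1.ne'
  · rw [h3]
    simp only [add_mul, mul_assoc, sum_add_distrib, ← mul_sum, hua v]
    simp
  · refine le_trans ?_ h4
    rw [sum_add_distrib, ← mul_sum]
    nlinarith

/-- Every fractional weighting can be rounded to a set without increasing the weighted degrees,
losing at most one element per degree constraint. -/
theorem exists_rounding {β V : Type*} [Fintype β] [DecidableEq β] [Fintype V]
    (a : β → V → ℝ) (ha : ∀ e v, 0 ≤ a e v) (w : β → ℝ) (hw : ∀ e, w e ∈ Set.Icc (0 : ℝ) 1) :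
    ∃ S : Finset β, (∀ e ∈ S, w e ≠ 0) ∧ (∀ v, ∑ e ∈ S, a e v ≤ ∑ e, w e * a e v) ∧
      ∑ e, w e ≤ S.card + Fintype.card V := by
  classical
  obtain ⟨w', h1, h2, h3, h4, h5⟩ := exists_few_fractional a w hw
  refine ⟨univ.filter fun e => w' e = 1, fun e he h => ?_, fun v => ?_, h4.trans ?_⟩
  · simp [h2 e h] at he
  · rw [← h3, sum_filter]
    refine sum_le_sum fun e _ => ?_
    split_ifs with h
    · simp [h]
    · exact mul_nonneg (h1 e).1 (ha e v)
  · calc ∑ e, w' e ≤ ∑ e, ((if w' e = 1 then (1 : ℝ) else 0) +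
          (if w' e ∈ Set.Ioo (0 : ℝ) 1 then 1 else 0)) := by
          refine sum_le_sum fun e _ => ?_
          rcases (h1 e).2.eq_or_lt with h | h
          · simp [h]
          · rcases (h1 e).1.eq_or_lt with h' | h'
            · simp [← h']
            · simp [h', h, h.ne, h.le]
      _ ≤ _ := by
          rw [sum_add_distrib, sum_boole, sum_boole]
          gcongr

theorem hDeg_le_choose {n k : ℕ} {H : Finset (Finset (Fin n))} (hH : ∀ e ∈ H, e.card = k)
    (S : Finset (Fin n)) : hDeg H S ≤ n.choose (k - S.card) := by
  calc hDeg H S ≤ (powersetCard (k - S.card) (univ : Finset (Fin n))).card := by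
        refine card_le_card_of_injOn (fun e => e \ S) ?_ ?_
        · intro e he
          simp only [coe_filter, Set.mem_ofPred_eq] at he
          simp [card_sdiff_of_subset he.2, hH e he.1]
        · intro e he e' he' h
          simp only [coe_filter, Set.mem_ofPred_eq] at he he'
          rw [← sdiff_union_of_subset he.2, ← sdiff_union_of_subset he'.2]
          simp only at h
          rw [h]
    _ = _ := by simp

theorem choose_add_one_mem_diracT {n k l : ℕ} (hl : l ≤ n) :
    n.choose (k - l) + 1 ∈ {d : ℕ | ∀ H : Finset (Finset (Fin n)), (∀ e ∈ H, e.card = k) →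
      (∀ S : Finset (Fin n), S.card = l → d ≤ hDeg H S) → ∃ M, HyperPM H M} := by
  intro H hH hd
  obtain ⟨S, -, hS⟩ := exists_subset_card_eq (s := (univ : Finset (Fin n))) (by simpa using hl)
  have h1 := hd S hS
  have h2 := hDeg_le_choose hH S
  rw [hS] at h2
  omega

theorem exists_hyperPM_of_diracT_le {n k l : ℕ} (hl : l ≤ n) {H : Finset (Finset (Fin n))}
    (hH : ∀ e ∈ H, e.card = k) (hd : ∀ S : Finset (Fin n), S.card = l → diracT n k l ≤ hDeg H S) :
    ∃ M, HyperPM H M :=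
  Nat.sInf_mem ⟨_, choose_add_one_mem_diracT hl⟩ H hH hd

theorem eventually_diracT_le {k l : ℕ} {c : ℝ} (hc : diracThreshold k l < c) :
    ∀ᶠ n : ℕ in Filter.atTop ⊓ Filter.principal {n | k ∣ n},
      (diracT n k l : ℝ) ≤ c * n.choose (k - l) := by
  have hbdd : Filter.IsBoundedUnder (· ≤ ·) (Filter.atTop ⊓ Filter.principal {n | k ∣ n})
      (fun n : ℕ => (diracT n k l : ℝ) / (n.choose (k - l))) := by
    refine Filter.isBoundedUnder_of_eventually_le (a := 2) ?_
    filter_upwards [(Filter.eventually_ge_atTop k).filter_mono inf_le_left,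
      (Filter.eventually_ge_atTop l).filter_mono inf_le_left] with n hk hl
    have hpos : 0 < n.choose (k - l) := Nat.choose_pos (by omega)
    have h1 : diracT n k l ≤ n.choose (k - l) + 1 := Nat.sInf_le (choose_add_one_mem_diracT hl)
    rw [div_le_iff₀ (by exact_mod_cast hpos)]
    exact_mod_cast (show diracT n k l ≤ 2 * n.choose (k - l) by omega)
  have h := Filter.eventually_lt_of_limsup_lt hc hbdd
  filter_upwards [h, (Filter.eventually_ge_atTop k).filter_mono inf_le_left] with n hn hk
  have hpos : 0 < n.choose (k - l) := Nat.choose_pos (by omega)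
  rw [div_lt_iff₀ (by exact_mod_cast hpos)] at hn
  exact hn.le

/-- The `k`-uniform hypergraph on `Fin m` whose hyperedges are the `k`-sets mapped by `f` onto
hyperedges of `H`. -/
def pullback {n m : ℕ} (k : ℕ) (H : Finset (Finset (Fin n))) (f : Fin m → Fin n) :
    Finset (Finset (Fin m)) :=
  univ.filter fun A => A.card = k ∧ A.image f ∈ H

theorem card_filter_forall_mem {ι α : Type*} [Fintype ι] [DecidableEq ι] [Fintype α]
    [DecidableEq α] (A : Finset ι) (e : Finset α)
    [DecidablePred fun f : ι → α => ∀ i ∈ A, f i ∈ e] :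
    (univ.filter fun f : ι → α => ∀ i ∈ A, f i ∈ e).card =
      e.card ^ A.card * Fintype.card α ^ (Fintype.card ι - A.card) := by
  have : (univ.filter fun f : ι → α => ∀ i ∈ A, f i ∈ e) =
      Fintype.piFinset fun i => if i ∈ A then e else univ := by
    ext f
    simp only [mem_filter, mem_univ, true_and, Fintype.mem_piFinset]
    refine forall_congr' fun i => ?_
    split_ifs with h <;> simp [h]
  rw [this, Fintype.card_piFinset]
  simp only [apply_ite card, prod_ite, prod_const, card_univ]
  congr 2
  · simp
  · rw [filter_not, card_sdiff_of_subset (filter_subset _ _)]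
    simp

theorem sum_sum_piecewise {ι α R : Type*} [Fintype ι] [DecidableEq ι] [Fintype α]
    [AddCommMonoid R] (I : Finset ι) (F : (ι → α) → R) :
    ∑ u : ι → α, ∑ h : ι → α, F (I.piecewise u h) = ∑ u : ι → α, ∑ _h : ι → α, F u := by
  rw [← Fintype.sum_prod_type', ← Fintype.sum_prod_type' (fun u _ => F u)]
  refine Fintype.sum_bijective (fun p : (ι → α) × (ι → α) =>
    (I.piecewise p.1 p.2, I.piecewise p.2 p.1)) ?_ _ _ fun _ => rfl
  apply Function.Involutive.bijective
  rintro ⟨u, h⟩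
  ext i <;> by_cases hi : i ∈ I <;> simp [hi]

/-- The number of functions extending `u` on `I` that map `A ⊇ I` onto `e ⊇ u(I)`. -/
theorem factorial_mul_pow_le_card_filter_image_eq {ι α : Type*} [Fintype ι] [DecidableEq ι]
    [Fintype α] [DecidableEq α] {I A : Finset ι} (hIA : I ⊆ A) (u : ι → α) (hu : Set.InjOn u I)
    {e : Finset α} (he : I.image u ⊆ e) (hcard : e.card = A.card) :
    (A.card - I.card).factorial * Fintype.card α ^ (Fintype.card ι - (A.card - I.card)) ≤
      (univ.filter fun h : ι → α => A.image (I.piecewise u h) = e).card := by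
  set J := A \ I with hJ
  set T := e \ I.image u with hT
  have hJc : J.card = A.card - I.card := card_sdiff_of_subset hIA
  have hTc : T.card = A.card - I.card := by
    rw [hT, card_sdiff_of_subset he, hcard, card_image_of_injOn hu]
  let Φ : (J ≃ T) × ({i // i ∉ J} → α) → (ι → α) := fun p i =>
    if h : i ∈ J then p.1 ⟨i, h⟩ else p.2 ⟨i, h⟩
  have hΦ : Function.Injective Φ := by
    rintro ⟨s, g⟩ ⟨s', g'⟩ h
    have h1 : s = s' := by
      ext ⟨i, hi⟩
      have := congrFun h i
      simpa [Φ, hi] using this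
    have h2 : g = g' := by
      ext ⟨i, hi⟩
      have := congrFun h i
      simpa [Φ, hi] using this
    rw [h1, h2]
  have hmem : ∀ p, A.image (I.piecewise u (Φ p)) = e := by
    rintro ⟨s, g⟩
    have hA : A = I ∪ J := by rw [hJ, union_sdiff_of_subset hIA]
    rw [hA, image_union]
    have h1 : I.image (I.piecewise u (Φ (s, g))) = I.image u :=
      image_congr fun i hi => by simp [mem_coe.1 hi]
    have h2 : J.image (I.piecewise u (Φ (s, g))) = T := by
      ext x
      simp only [mem_image]
      constructor
      · rintro ⟨i, hi, rfl⟩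
        have hiI : i ∉ I := (mem_sdiff.1 hi).2
        simp only [hiI, not_false_eq_true, piecewise_eq_of_notMem, Φ, hi, dif_pos]
        exact (s ⟨i, hi⟩).2
      · intro hx
        refine ⟨(s.symm ⟨x, hx⟩ : J), (s.symm ⟨x, hx⟩).2, ?_⟩
        have hiI : ((s.symm ⟨x, hx⟩ : J) : ι) ∉ I := (mem_sdiff.1 (s.symm ⟨x, hx⟩).2).2
        simp [hiI, Φ]
    rw [h1, h2, hT, union_sdiff_of_subset he]
  calc _ = Fintype.card ((J ≃ T) × ({i // i ∉ J} → α)) := by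
        rw [Fintype.card_prod, Fintype.card_equiv (Fintype.equivOfCardEq (by simp [hJc, hTc])),
          Fintype.card_fun, Fintype.card_subtype_compl]
        simp [hJc]
    _ ≤ _ := by
        rw [← card_univ, ← card_image_of_injective _ hΦ]
        refine card_le_card fun h hh => ?_
        obtain ⟨p, -, rfl⟩ := mem_image.1 hh
        simpa using hmem p

theorem choose_le_card_filter_superset {ι : Type*} [Fintype ι] [DecidableEq ι] (I : Finset ι)
    {k : ℕ} (hk : I.card ≤ k) :
    (Fintype.card ι - I.card).choose (k - I.card) ≤
      (univ.filter fun A : Finset ι => A.card = k ∧ I ⊆ A).card := by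
  calc _ = (powersetCard (k - I.card) (univ \ I)).card := by
        rw [card_powersetCard, card_sdiff_of_subset (subset_univ _), card_univ]
    _ ≤ _ := by
        refine card_le_card_of_injOn (fun J => I ∪ J) ?_ ?_
        · intro J hJ
          rw [mem_coe, mem_powersetCard] at hJ
          have hd : Disjoint I J := (disjoint_sdiff.mono_right hJ.1)
          simp only [coe_filter, Set.mem_ofPred_eq, mem_univ, true_and, subset_union_left, and_true]
          rw [card_union_of_disjoint hd]
          omega
        · intro J hJ J' hJ' h
          rw [mem_coe, mem_powersetCard] at hJ hJ'
          have hd : Disjoint J I := (disjoint_sdiff.mono_right hJ.1).symm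
          have hd' : Disjoint J' I := (disjoint_sdiff.mono_right hJ'.1).symm
          simp only at h
          rw [← union_sdiff_cancel_left hd.symm, h, union_sdiff_cancel_left hd'.symm]

theorem le_sum_hDeg_pullback {n m k : ℕ} {H : Finset (Finset (Fin n))}
    (hH : ∀ e ∈ H, e.card = k) (I : Finset (Fin m)) (hIk : I.card ≤ k) (u : Fin m → Fin n)
    (hu : Set.InjOn u I) :
    (m - I.card).choose (k - I.card) * (hDeg H (I.image u) *
      ((k - I.card).factorial * n ^ (m - (k - I.card)))) ≤
      ∑ h : Fin m → Fin n, hDeg (pullback k H (I.piecewise u h)) I := by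
  have hA : ∀ A : Finset (Fin m), A.card = k ∧ I ⊆ A → hDeg H (I.image u) *
      ((k - I.card).factorial * n ^ (m - (k - I.card))) ≤
      (univ.filter fun h : Fin m → Fin n => A.image (I.piecewise u h) ∈ H).card := by
    rintro A ⟨hAk, hIA⟩
    calc _ = ∑ e ∈ H.filter (fun e => I.image u ⊆ e),
          ((k - I.card).factorial * n ^ (m - (k - I.card))) := by
          rw [sum_const, smul_eq_mul]; rfl
      _ ≤ ∑ e ∈ H.filter (fun e => I.image u ⊆ e),
          (univ.filter fun h : Fin m → Fin n => A.image (I.piecewise u h) = e).card := by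
          refine sum_le_sum fun e he => ?_
          rw [mem_filter] at he
          have := factorial_mul_pow_le_card_filter_image_eq hIA u hu he.2 (by rw [hH e he.1, hAk])
          simpa [hAk] using this
      _ = _ := by
          rw [← card_biUnion]
          · congr 1
            ext h
            simp only [mem_biUnion, mem_filter, mem_univ, true_and]
            constructor
            · rintro ⟨e, he, rfl⟩
              exact he.1
            · intro h'
              refine ⟨_, ⟨h', ?_⟩, rfl⟩
              intro x hx
              obtain ⟨i, hi, rfl⟩ := mem_image.1 hx
              exact mem_image.2 ⟨i, hIA hi, by simp [hi]⟩
          · intro e _ e' _ hne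
            rw [Function.onFun, disjoint_left]
            intro h hh hh'
            simp only [mem_filter, mem_univ, true_and] at hh hh'
            exact hne (hh.symm.trans hh')
  have hswap : ∑ h : Fin m → Fin n, hDeg (pullback k H (I.piecewise u h)) I =
      ∑ A ∈ univ.filter (fun A : Finset (Fin m) => A.card = k ∧ I ⊆ A),
        (univ.filter fun h : Fin m → Fin n => A.image (I.piecewise u h) ∈ H).card := by
    simp only [card_filter]
    rw [sum_comm]
    refine sum_congr rfl fun h _ => ?_
    rw [← card_filter, filter_filter]
    unfold hDeg pullback
    rw [filter_filter]
    congr 1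
    ext A
    simp only [mem_filter, mem_univ, true_and]
    tauto
  rw [hswap]
  calc _ ≤ (univ.filter (fun A : Finset (Fin m) => A.card = k ∧ I ⊆ A)).card * _ :=
        Nat.mul_le_mul_right _ (by simpa using choose_le_card_filter_superset I hIk)
    _ ≤ _ := by
        rw [← smul_eq_mul, ← sum_const]
        refine sum_le_sum fun A hAm => hA A ?_
        simpa using hAm

theorem abs_card_filter_sub_le {β : Type*} {s : Finset β} {p q r : β → Prop} [DecidablePred p]
    [DecidablePred q] [DecidablePred r] (h : ∀ x ∈ s, ¬ r x → (p x ↔ q x)) :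
    |((s.filter p).card : ℝ) - (s.filter q).card| ≤ (s.filter r).card := by
  simp only [card_filter, Nat.cast_sum]
  rw [← sum_sub_distrib]
  refine (abs_sum_le_sum_abs _ _).trans (sum_le_sum fun x hx => ?_)
  by_cases hr : r x
  · by_cases hp : p x <;> by_cases hq : q x <;> simp [hr, hp, hq]
  · have := h x hx hr
    by_cases hq : q x <;> simp [hr, hq, this]

theorem abs_hDeg_pullback_update_sub_le {n m k : ℕ} (H : Finset (Finset (Fin n)))
    (I : Finset (Fin m)) (u f : Fin m → Fin n) (i : Fin m) (a : Fin n) :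
    |(hDeg (pullback k H (I.piecewise u (Function.update f i a))) I : ℝ) -
      hDeg (pullback k H (I.piecewise u f)) I| ≤ m.choose (k - (I.card + 1)) := by
  by_cases hi : i ∈ I
  · have : I.piecewise u (Function.update f i a) = I.piecewise u f := by
      ext j
      by_cases hj : j ∈ I
      · simp [hj]
      · have : j ≠ i := by rintro rfl; exact hj hi
        simp [hj, this]
    simp [this]
  · have h1 : hDeg (powersetCard k (univ : Finset (Fin m))) (insert i I) ≤
        m.choose (k - (I.card + 1)) := by
      rw [← card_insert_of_notMem hi]
      exact hDeg_le_choose (fun e he => (mem_powersetCard.1 he).2) _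
    refine le_trans ?_ (Nat.cast_le.2 h1)
    have h2 : ∀ f : Fin m → Fin n, hDeg (pullback k H f) I =
        ((powersetCard k (univ : Finset (Fin m))).filter fun A => A.image f ∈ H ∧ I ⊆ A).card := by
      intro f
      unfold hDeg pullback
      rw [filter_filter]
      congr 1
      ext A
      simp only [mem_filter, mem_univ, true_and, mem_powersetCard, subset_univ]
      tauto
    rw [h2, h2]
    refine abs_card_filter_sub_le fun A _ hA => ?_
    by_cases hIA : I ⊆ A
    · have hiA : i ∉ A := fun h => hA (insert_subset h hIA)
      have : A.image (I.piecewise u (Function.update f i a)) = A.image (I.piecewise u f) := by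
        refine image_congr fun j hj => ?_
        have : j ≠ i := by rintro rfl; exact hiA hj
        by_cases hj : j ∈ I <;> simp [hj, this]
      rw [this]
    · simp [hIA]

/-- For a fixed index set `I`, few functions are injective on `I` and pull `H` back to a hypergraph
in which `I` has small degree. -/
theorem card_filter_hDeg_pullback_lt {n m k : ℕ} (hn : 0 < n) (hm : 0 < m)
    {H : Finset (Finset (Fin n))} (hH : ∀ e ∈ H, e.card = k) (I : Finset (Fin m))
    (hIk : I.card < k) (hkm : k ≤ m) {b t d : ℝ} (ht : 0 ≤ t)
    (hd : ∀ S : Finset (Fin n), S.card = I.card → d ≤ hDeg H S)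
    (hb : (b + t) * (n : ℝ) ^ (k - I.card) ≤
      (m - I.card).choose (k - I.card) * ((k - I.card).factorial * d)) :
    ((univ.filter fun f : Fin m → Fin n =>
      Set.InjOn f I ∧ (hDeg (pullback k H f) I : ℝ) < b).card : ℝ) ≤
      (n : ℝ) ^ m * Real.exp (-(t ^ 2 / (2 * m * (m.choose (k - (I.card + 1)) : ℝ) ^ 2))) := by
  classical
  have : Nonempty (Fin n) := ⟨⟨0, hn⟩⟩
  set P : (Fin m → Fin n) → Prop := fun f =>
    Set.InjOn f I ∧ (hDeg (pullback k H f) I : ℝ) < b with hP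
  set B := (n : ℝ) ^ m * Real.exp (-(t ^ 2 / (2 * m * (m.choose (k - (I.card + 1)) : ℝ) ^ 2)))
    with hB
  have hNpos : (0 : ℝ) < (n : ℝ) ^ m := by positivity
  have hkey : ∀ u : Fin m → Fin n,
      ((univ.filter fun h : Fin m → Fin n => P (I.piecewise u h)).card : ℝ) ≤ B := by
    intro u
    by_cases hu : Set.InjOn u I
    · have hmono : (univ.filter fun h : Fin m → Fin n => P (I.piecewise u h)) ⊆
          univ.filter fun h : Fin m → Fin n =>
            (hDeg (pullback k H (I.piecewise u h)) I : ℝ) < b :=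
        monotone_filter_right _ fun h _ hh => hh.2
      refine (Nat.cast_le.2 (card_le_card hmono)).trans ?_
      have := card_filter_le_of_bounded_differences (α := Fin n) hm
        (m.choose (k - (I.card + 1)) : ℝ) t b
        (by exact_mod_cast Nat.choose_pos (by omega)) ht
        (fun h => (hDeg (pullback k H (I.piecewise u h)) I : ℝ))
        (abs_hDeg_pullback_update_sub_le H I u) (by
          have h1 := le_sum_hDeg_pullback hH I hIk.le u hu
          have h2 := hd (I.image u) (card_image_of_injOn hu)
          rw [Fintype.card_fin]
          have h3 : ((m - I.card).choose (k - I.card) : ℝ) * (hDeg H (I.image u) *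
              ((k - I.card).factorial * (n : ℝ) ^ (m - (k - I.card)))) ≤
              ∑ h : Fin m → Fin n, (hDeg (pullback k H (I.piecewise u h)) I : ℝ) := by
            exact_mod_cast h1
          refine le_trans ?_ h3
          calc (b + t) * (n : ℝ) ^ m
              = (b + t) * (n : ℝ) ^ (k - I.card) * (n : ℝ) ^ (m - (k - I.card)) := by
                rw [mul_assoc, ← pow_add]; congr 2; omega
            _ ≤ (m - I.card).choose (k - I.card) * ((k - I.card).factorial * d) *
                (n : ℝ) ^ (m - (k - I.card)) := by gcongr
            _ ≤ (m - I.card).choose (k - I.card) *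
                ((k - I.card).factorial * (hDeg H (I.image u) : ℝ)) *
                (n : ℝ) ^ (m - (k - I.card)) := by gcongr
            _ = _ := by ring)
      simpa [hB] using this
    · have : (univ.filter fun h : Fin m → Fin n => P (I.piecewise u h)) = ∅ := by
        rw [filter_eq_empty_iff]
        rintro h - ⟨hh, -⟩
        refine hu fun i hi j hj hij => hh hi hj ?_
        rw [mem_coe] at hi hj
        simp [hi, hj, hij]
      rw [this, hB]
      simp only [card_empty, Nat.cast_zero]
      positivity
  have hdc := sum_sum_piecewise I (fun f : Fin m → Fin n => if P f then (1 : ℝ) else 0)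
  simp only [sum_const, card_univ, Fintype.card_fun, Fintype.card_fin, nsmul_eq_mul,
    ← mul_sum] at hdc
  have hsum : ∑ u : Fin m → Fin n,
      ((univ.filter fun h : Fin m → Fin n => P (I.piecewise u h)).card : ℝ) ≤ (n : ℝ) ^ m * B := by
    refine (sum_le_sum fun u _ => hkey u).trans ?_
    simp
  simp only [card_filter, Nat.cast_sum, Nat.cast_ite, Nat.cast_one, Nat.cast_zero] at hsum ⊢
  refine le_of_mul_le_mul_left ?_ hNpos
  refine le_trans (le_of_eq ?_) hsum
  convert hdc.symm using 2
  push_cast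
  rfl

/-- Averaging the perfect matchings of many pullbacks of `H` gives a weighting of the hyperedges
with almost equal vertex degrees, which is then rounded to a subhypergraph. -/
theorem exists_subhypergraph_of_pullback {n m k : ℕ} (hn : 0 < n) (hk : 0 < k) (hm : 0 < m)
    (hkm : k ≤ m) {H : Finset (Finset (Fin n))} (hH : ∀ e ∈ H, e.card = k)
    (G : Finset (Fin m → Fin n)) (hG : ∀ f ∈ G, ∃ M, HyperPM (pullback k H f) M) :
    ∃ H' ⊆ H, (G.card : ℝ) * m / (k * (2 ^ m * k ^ k * (n : ℝ) ^ (m - k))) ≤ H'.card + n ∧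
      ∀ v, (hDeg H' {v} : ℝ) ≤ m * (n : ℝ) ^ (k - 1) / (2 ^ m * k ^ k) := by
  have hG' : ∀ f, ∃ M : Finset (Finset (Fin m)), f ∈ G → HyperPM (pullback k H f) M := by
    intro f
    by_cases hf : f ∈ G
    · obtain ⟨M, hM⟩ := hG f hf
      exact ⟨M, fun _ => hM⟩
    · exact ⟨∅, fun h => absurd h hf⟩
  choose M hM using hG'
  have hMk : ∀ f ∈ G, ∀ A ∈ M f, A.card = k ∧ A.image f ∈ H := fun f hf A hA => by
    simpa [pullback] using (hM f hf).1 hA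
  set K : ℝ := 2 ^ m * k ^ k * (n : ℝ) ^ (m - k) with hK
  have hKpos : 0 < K := by positivity
  set W : Finset (Fin n) → ℕ := fun e => ∑ f ∈ G, ((M f).filter fun A => A.image f = e).card
    with hW
  clear_value K W
  have hW0 : ∀ e, W e ≠ 0 → e ∈ H := by
    intro e he
    rw [hW] at he
    obtain ⟨f, hf, h⟩ := exists_ne_zero_of_sum_ne_zero he
    obtain ⟨A, hA⟩ := card_ne_zero.1 h
    rw [mem_filter] at hA
    rw [← hA.2]
    exact (hMk f hf A hA.1).2
  have hWK : ∀ e, (W e : ℝ) ≤ K := by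
    intro e
    by_cases he : W e = 0
    · rw [he]; simpa using hKpos.le
    have hek := hH e (hW0 e he)
    have h1 : W e ≤ 2 ^ m * (k ^ k * n ^ (m - k)) := by
      calc W e ≤ ∑ f : Fin m → Fin n,
            (univ.filter fun A : Finset (Fin m) => A.card = k ∧ A.image f = e).card := by
            rw [hW]
            simp only
            refine (sum_le_sum fun f hf => card_le_card ?_).trans
              (sum_le_sum_of_subset (subset_univ G))
            intro A hA
            rw [mem_filter] at hA ⊢
            exact ⟨mem_univ _, (hMk f hf A hA.1).1, hA.2⟩
        _ = ∑ A : Finset (Fin m),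
            (univ.filter fun f : Fin m → Fin n => A.card = k ∧ A.image f = e).card := by
            simp only [card_filter]
            exact sum_comm
        _ ≤ ∑ _A : Finset (Fin m), k ^ k * n ^ (m - k) := by
            refine sum_le_sum fun A _ => ?_
            by_cases hA : A.card = k
            · refine (card_le_card ?_).trans
                (le_of_eq ((card_filter_forall_mem (α := Fin n) A e).trans ?_))
              · intro f hf
                rw [mem_filter] at hf ⊢
                refine ⟨mem_univ _, fun i hi => ?_⟩
                rw [← hf.2.2]
                exact mem_image_of_mem f hi
              · rw [hek, hA, Fintype.card_fin, Fintype.card_fin]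
            · simp [hA]
        _ = _ := by simp
    rw [hK, mul_assoc]
    exact_mod_cast h1
  obtain ⟨H', h1, h2, h3⟩ := exists_rounding (β := Finset (Fin n)) (V := Fin n)
    (fun e v => if v ∈ e then 1 else 0) (fun e v => by positivity) (fun e => W e / K)
    (fun e => ⟨div_nonneg (Nat.cast_nonneg _) hKpos.le, (div_le_one hKpos).2 (hWK e)⟩)
  refine ⟨H', fun e he => hW0 e fun h => h1 e he (by simp [h]), ?_, fun v => ?_⟩
  · rw [Fintype.card_fin] at h3
    refine le_trans (le_of_eq ?_) h3
    have hMm : ∀ f ∈ G, (M f).card * k = m := by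
      intro f hf
      have h := congrArg card (hM f hf).2.2
      rw [card_biUnion (hM f hf).2.1] at h
      simp only [id, card_univ, Fintype.card_fin] at h
      rw [sum_congr rfl fun A hA => (hMk f hf A hA).1] at h
      simpa using h
    have htot : (∑ e, W e) * k = G.card * m := by
      rw [hW, sum_comm, sum_mul, ← smul_eq_mul, ← sum_const]
      refine sum_congr rfl fun f hf => ?_
      rw [← card_eq_sum_card_fiberwise (fun _ _ => mem_univ _), hMm f hf]
    rw [← sum_div]
    have htot' : (∑ e, (W e : ℝ)) * k = G.card * m := by exact_mod_cast htot
    rw [← htot']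
    field_simp
  · have hdeg : (hDeg H' {v} : ℝ) = ∑ e ∈ H', if v ∈ e then 1 else 0 := by
      rw [sum_boole]
      simp [hDeg]
    have hWv : ∑ e, (if v ∈ e then W e else 0) ≤ m * n ^ (m - 1) := by
      calc ∑ e, (if v ∈ e then W e else 0)
          = ∑ f ∈ G, ((M f).filter fun A => v ∈ A.image f).card := by
            rw [← sum_filter, hW, sum_comm]
            refine sum_congr rfl fun f _ => ?_
            rw [card_eq_sum_card_fiberwise (f := fun A : Finset (Fin m) => A.image f)
              (t := univ.filter fun e => v ∈ e) (fun A hA => by simpa using (mem_filter.1 hA).2)]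
            refine sum_congr rfl fun e he => ?_
            rw [filter_filter]
            congr 1
            ext A
            simp only [mem_filter, mem_univ, true_and] at he ⊢
            constructor
            · rintro ⟨hA, rfl⟩
              exact ⟨hA, he, rfl⟩
            · rintro ⟨hA, -, h⟩
              exact ⟨hA, h⟩
        _ ≤ ∑ f ∈ G, (univ.filter fun i => f i = v).card := by
            refine sum_le_sum fun f hf => ?_
            have hex : ∀ A : Finset (Fin m), ∃ i, v ∈ A.image f → i ∈ A ∧ f i = v := by
              intro A
              by_cases hv : v ∈ A.image f
              · obtain ⟨i, hi⟩ := mem_image.1 hv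
                exact ⟨i, fun _ => hi⟩
              · exact ⟨⟨0, hm⟩, fun h => absurd h hv⟩
            choose i hi using hex
            refine card_le_card_of_injOn i ?_ ?_
            · intro A hA
              rw [mem_coe, mem_filter] at hA
              simpa using (hi A hA.2).2
            · intro A hA B hB hAB
              rw [mem_coe, mem_filter] at hA hB
              by_contra hne
              exact disjoint_left.1 ((hM f hf).2.1 hA.1 hB.1 hne) (hi A hA.2).1
                (hAB ▸ (hi B hB.2).1)
        _ ≤ ∑ f : Fin m → Fin n, (univ.filter fun i => f i = v).card :=
            sum_le_sum_of_subset (subset_univ G)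
        _ = ∑ i : Fin m, (univ.filter fun f : Fin m → Fin n => f i = v).card := by
            simp only [card_filter]
            exact sum_comm
        _ = ∑ _i : Fin m, n ^ (m - 1) := by
            refine sum_congr rfl fun i _ => ?_
            simpa using card_filter_forall_mem (α := Fin n) {i} {v}
        _ = _ := by simp
    rw [hdeg]
    refine (h2 v).trans ?_
    have hWv' : ∑ e, (W e / K) * (if v ∈ e then (1 : ℝ) else 0) ≤ m * (n : ℝ) ^ (m - 1) / K := by
      rw [le_div_iff₀ hKpos, sum_mul]
      refine le_trans (le_of_eq ?_) (Nat.cast_le.2 hWv |>.trans (le_of_eq (by push_cast; rfl)))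
      push_cast
      refine sum_congr rfl fun e _ => ?_
      split_ifs
      · field_simp
      · simp
    refine hWv'.trans (le_of_eq ?_)
    rw [hK, show m - 1 = (k - 1) + (m - k) by omega, pow_add]
    field_simp

theorem card_filter_injective (n m : ℕ) :
    (univ.filter fun f : Fin m → Fin n => Function.Injective f).card = n.descFactorial m := by
  rw [← Fintype.card_subtype,
    Fintype.card_congr (Equiv.subtypeInjectiveEquivEmbedding (Fin m) (Fin n)),
    Fintype.card_embedding_eq]
  simp

/-- Most functions pull `H` back to a hypergraph with a perfect matching. -/
theorem exists_many_pullback_hyperPM {n m k l : ℕ} (hn : 0 < n) (hlk : l < k) (hkm : k ≤ m)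
    {H : Finset (Finset (Fin n))} (hH : ∀ e ∈ H, e.card = k) {b t d : ℝ} (ht : 0 ≤ t)
    (hd : ∀ S : Finset (Fin n), S.card = l → d ≤ hDeg H S)
    (hb : (b + t) * (n : ℝ) ^ (k - l) ≤ (m - l).choose (k - l) * ((k - l).factorial * d))
    (hbm : (diracT m k l : ℝ) ≤ b) :
    ∃ G : Finset (Fin m → Fin n), (∀ f ∈ G, ∃ M, HyperPM (pullback k H f) M) ∧
      (n.descFactorial m : ℝ) ≤ G.card + m.choose l *
        ((n : ℝ) ^ m * Real.exp (-(t ^ 2 / (2 * m * (m.choose (k - (l + 1)) : ℝ) ^ 2)))) := by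
  classical
  set bad : Finset (Fin m) → Finset (Fin m → Fin n) := fun I =>
    univ.filter fun f => Set.InjOn f I ∧ (hDeg (pullback k H f) I : ℝ) < b with hbad
  refine ⟨(univ.filter fun f : Fin m → Fin n => Function.Injective f) \
    (powersetCard l univ).biUnion bad, fun f hf => ?_, ?_⟩
  · simp only [mem_sdiff, mem_filter, mem_univ, true_and, mem_biUnion, mem_powersetCard,
      subset_univ, not_exists, not_and, hbad, not_lt] at hf
    refine exists_hyperPM_of_diracT_le (l := l) (by omega)
      (fun A hA => (mem_filter.1 hA).2.1) fun S hS => ?_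
    exact_mod_cast hbm.trans (hf.2 S hS hf.1.injOn)
  · rw [← card_filter_injective]
    have h1 : ((univ.filter fun f : Fin m → Fin n => Function.Injective f).card : ℝ) ≤
        ((univ.filter fun f : Fin m → Fin n => Function.Injective f) \
          (powersetCard l univ).biUnion bad).card + ((powersetCard l univ).biUnion bad).card := by
      exact_mod_cast card_le_card_sdiff_add_card
    refine h1.trans ?_
    gcongr
    refine (Nat.cast_le.2 card_biUnion_le).trans ?_
    push_cast
    refine (sum_le_sum (g := fun _ => (n : ℝ) ^ m *
      Real.exp (-(t ^ 2 / (2 * m * (m.choose (k - (l + 1)) : ℝ) ^ 2)))) fun I hI => ?_).trans ?_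
    · obtain ⟨-, rfl⟩ := mem_powersetCard.1 hI
      convert card_filter_hDeg_pullback_lt hn (by omega) hH I hlk hkm ht hd hb
    · simp

open Filter Topology in
theorem tendsto_factorial_mul_choose_div_pow (r : ℕ) :
    Tendsto (fun n : ℕ => (r.factorial * n.choose r : ℝ) / (n : ℝ) ^ r) atTop (𝓝 1) := by
  have hz : ∀ᶠ n : ℕ in atTop, ((n : ℝ) ^ r / r.factorial) ≠ 0 := by
    filter_upwards [eventually_gt_atTop 0] with n hn
    positivity
  refine ((Asymptotics.isEquivalent_iff_tendsto_one hz).1 (isEquivalent_choose r)).congr fun n => ?_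
  simp only [Pi.div_apply]
  field_simp

open Filter Topology in
theorem tendsto_choose_sub_div_choose (l r : ℕ) :
    Tendsto (fun n : ℕ => ((n - l).choose r : ℝ) / n.choose r) atTop (𝓝 1) := by
  have h1 := (tendsto_factorial_mul_choose_div_pow r).comp (tendsto_sub_atTop_nat l)
  have h2 := tendsto_factorial_mul_choose_div_pow r
  have h3 : Tendsto (fun n : ℕ => (((n - l : ℕ) : ℝ) / n) ^ r) atTop (𝓝 1) := by
    have h4 : Tendsto (fun n : ℕ => ((n - l : ℕ) : ℝ) / n) atTop (𝓝 1) := by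
      have h5 : Tendsto (fun n : ℕ => 1 - (l : ℝ) / n) atTop (𝓝 1) := by
        simpa using tendsto_const_nhds.sub (tendsto_const_div_atTop_nhds_zero_nat (l : ℝ))
      refine h5.congr' ?_
      filter_upwards [eventually_gt_atTop l] with n hn
      have : (0 : ℝ) < n := by exact_mod_cast (by omega : 0 < n)
      rw [Nat.cast_sub hn.le]
      field_simp
    simpa using h4.pow r
  have h6 := (h1.div h2 one_ne_zero).mul h3
  simp only [div_one, mul_one] at h6
  refine h6.congr' ?_
  filter_upwards [eventually_gt_atTop (l + r)] with n hn
  have ha : (0 : ℝ) < n := by exact_mod_cast (by omega : 0 < n)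
  have hb : (0 : ℝ) < ((n - l : ℕ) : ℝ) := by exact_mod_cast (by omega : 0 < n - l)
  have hc : (0 : ℝ) < n.choose r := by exact_mod_cast Nat.choose_pos (by omega)
  simp only [Function.comp, Pi.div_apply, div_pow]
  field_simp

open Filter Topology in
theorem tendsto_pow_mul_exp_neg_mul_nat (l : ℕ) {κ : ℝ} (hκ : 0 < κ) :
    Tendsto (fun n : ℕ => (n : ℝ) ^ l * Real.exp (-(κ * n))) atTop (𝓝 0) := by
  have h1 : Tendsto (fun n : ℕ => κ * (n : ℝ)) atTop atTop :=
    tendsto_natCast_atTop_atTop.const_mul_atTop hκ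
  have h2 := ((Real.tendsto_pow_mul_exp_neg_atTop_nhds_zero l).comp h1).const_mul ((κ ^ l)⁻¹)
  rw [mul_zero] at h2
  refine h2.congr fun n => ?_
  simp only [Function.comp, mul_pow]
  field_simp

theorem half_div_mul_choose_le {m r : ℕ} (hm : 2 * (r + 1) ≤ m) :
    (m : ℝ) / (2 * (r + 1)) * m.choose r ≤ m.choose (r + 1) := by
  have h1 : (m.choose (r + 1) : ℝ) * (r + 1) = m.choose r * ((m : ℝ) - r) := by
    rw [← Nat.cast_sub (by omega)]
    exact_mod_cast Nat.choose_succ_right_eq m r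
  have h2 : (2 * (r + 1) : ℝ) ≤ m := by exact_mod_cast hm
  have h3 : (0 : ℝ) ≤ m.choose r := by positivity
  rw [div_mul_eq_mul_div, div_le_iff₀ (by positivity)]
  nlinarith

open Filter Topology in
/-- The failure probability in the union bound over all `l`-sets is eventually small. -/
theorem eventually_union_bound (l r : ℕ) {ε η : ℝ} (hε : 0 < ε) (hη : 0 < η) :
    ∀ᶠ m : ℕ in atTop, (m.choose l : ℝ) *
      Real.exp (-((ε * m.choose (r + 1)) ^ 2 / (2 * m * (m.choose r : ℝ) ^ 2))) ≤ η := by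
  set κ : ℝ := ε ^ 2 / (8 * (r + 1) ^ 2) with hκ
  have hκ0 : 0 < κ := by positivity
  filter_upwards [(tendsto_pow_mul_exp_neg_mul_nat l hκ0).eventually_le_const hη,
    eventually_ge_atTop (2 * (r + 1))] with m hm hmr
  refine le_trans ?_ hm
  have hm0 : (0 : ℝ) < m := by exact_mod_cast (by omega : 0 < m)
  have hc : (0 : ℝ) < m.choose r := by exact_mod_cast Nat.choose_pos (by omega)
  gcongr
  · exact_mod_cast Nat.choose_le_pow m l
  · rw [le_div_iff₀ (by positivity)]
    calc κ * m * (2 * m * (m.choose r : ℝ) ^ 2)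
        = (ε * ((m : ℝ) / (2 * (r + 1)) * m.choose r)) ^ 2 := by
          rw [hκ]; field_simp; ring
      _ ≤ _ := by
          gcongr
          exact half_div_mul_choose_le hmr

open Filter Topology in
/-- Choice of the sample size. -/
theorem exists_sample_size {k l : ℕ} (hlk : l < k) {ε η : ℝ} (hε : 0 < ε) (hη : 0 < η) :
    ∃ m : ℕ, k ≤ m ∧
      (diracT m k l : ℝ) ≤ (diracThreshold k l + ε / 2) * m.choose (k - l) ∧
      (diracThreshold k l + 3 * ε / 4) * m.choose (k - l) ≤
        (diracThreshold k l + 7 * ε / 8) * (m - l).choose (k - l) ∧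
      (m.choose l : ℝ) * Real.exp (-((ε / 4 * m.choose (k - l)) ^ 2 /
        (2 * m * (m.choose (k - (l + 1)) : ℝ) ^ 2))) ≤ η := by
  have hne : (atTop ⊓ 𝓟 {n : ℕ | k ∣ n}).NeBot := by
    rw [← frequently_mem_iff_neBot, frequently_atTop]
    exact fun a => ⟨k * a, Nat.le_mul_of_pos_left _ (by omega), dvd_mul_right _ _⟩
  set δ := diracThreshold k l with hδ
  have h1 := eventually_diracT_le (k := k) (l := l) (c := δ + ε / 2) (by linarith)
  have h2 : ∀ᶠ m : ℕ in atTop, (δ + 3 * ε / 4) * m.choose (k - l) ≤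
      (δ + 7 * ε / 8) * (m - l).choose (k - l) := by
    have := (tendsto_choose_sub_div_choose l (k - l)).const_mul (δ + 7 * ε / 8)
    rw [mul_one] at this
    filter_upwards [this.eventually_const_le (show δ + 3 * ε / 4 < δ + 7 * ε / 8 by linarith),
      eventually_ge_atTop k] with m hm hmk
    have hc : (0 : ℝ) < m.choose (k - l) := by exact_mod_cast Nat.choose_pos (by omega)
    rwa [← mul_div_assoc, le_div_iff₀ hc] at hm
  have h3 := eventually_union_bound l (k - (l + 1)) (ε := ε / 4) (by positivity) hη
  rw [show k - (l + 1) + 1 = k - l by omega] at h3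
  obtain ⟨m, ⟨hm1, hm2, hm3⟩, hm4⟩ := (h1.and ((h2.and (h3.and (eventually_ge_atTop k))).filter_mono
    inf_le_left)).exists.imp fun m hm => (⟨⟨hm.1, hm.2.1, hm.2.2.1⟩, hm.2.2.2⟩ :
      ((diracT m k l : ℝ) ≤ (δ + ε / 2) * m.choose (k - l) ∧ _ ∧ _) ∧ _)
  exact ⟨m, hm4, hm1, hm2, hm3⟩

/-- Regularity boosting: for `1 ≤ ℓ < k` and `ε, γ > 0` there exist `γ' > 0` and `n₀` such that
every `k`-uniform hypergraph on `n ≥ n₀` vertices with `δ_ℓ(𝓗) ≥ (δ⁺_{ℓ,k} + ε) C(n,k-ℓ)`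
contains a subhypergraph `𝓗'` with at least `γ' C(n,k)` hyperedges and maximum vertex degree
at most `(1+γ) γ' C(n,k-1)`. -/
theorem statement8 :
    ∀ k l : ℕ, 1 ≤ l → l < k → ∀ ε γ : ℝ, 0 < ε → 0 < γ →
    ∃ γ' : ℝ, 0 < γ' ∧ ∃ n₀ : ℕ, ∀ n : ℕ, n₀ ≤ n →
    ∀ H : Finset (Finset (Fin n)), (∀ e ∈ H, e.card = k) →
    (∀ S : Finset (Fin n), S.card = l →
      (diracThreshold k l + ε) * (n.choose (k - l) : ℝ) ≤ (hDeg H S : ℝ)) →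
    ∃ H' ⊆ H, γ' * (n.choose k : ℝ) ≤ (H'.card : ℝ) ∧
      ∀ v : Fin n, (hDeg H' {v} : ℝ) ≤ (1 + γ) * γ' * (n.choose (k - 1) : ℝ) := by
  intro k l hl hlk ε γ hε hγ
  set η : ℝ := γ / (4 * (1 + γ)) with hη
  have hη0 : 0 < η := by positivity
  have hγη : (1 + γ) * (1 - 2 * η) = 1 + γ / 2 := by rw [hη]; field_simp; ring
  have hη1 : 0 < 1 - 2 * η := by
    have : 0 < (1 + γ) * (1 - 2 * η) := by rw [hγη]; positivity
    exact pos_of_mul_pos_right this (by positivity)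
  obtain ⟨m, hkm, hm1, hm2, hm3⟩ := exists_sample_size hlk hε (half_pos hη0)
  have hm0 : 0 < m := by omega
  have hk0 : 0 < k := by omega
  set δ := diracThreshold k l with hδ
  set K : ℝ := 2 ^ m * k ^ k with hK
  have hKpos : 0 < K := by positivity
  set γ₀ : ℝ := m * (k - 1).factorial / K with hγ₀
  have hγ₀pos : 0 < γ₀ := by positivity
  have hkfac : (k.factorial : ℝ) = k * (k - 1).factorial := by
    exact_mod_cast (Nat.mul_factorial_pred hk0.ne').symm
  refine ⟨(1 - 2 * η) * γ₀, by positivity, ?_⟩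
  rw [← Filter.eventually_atTop]
  have hD : ∀ᶠ n : ℕ in Filter.atTop, (δ + 7 * ε / 8) * (n : ℝ) ^ (k - l) ≤
      (k - l).factorial * ((δ + ε) * n.choose (k - l)) := by
    have := (tendsto_factorial_mul_choose_div_pow (k - l)).const_mul (δ + ε)
    rw [mul_one] at this
    filter_upwards [this.eventually_const_le (show δ + 7 * ε / 8 < δ + ε by linarith),
      Filter.eventually_gt_atTop 0] with n hn hn0
    rw [← mul_div_assoc, le_div_iff₀ (by positivity)] at hn
    linarith
  have hE : ∀ᶠ n : ℕ in Filter.atTop, (1 - η / 2) * (n : ℝ) ^ m ≤ n.descFactorial m := by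
    filter_upwards [(tendsto_factorial_mul_choose_div_pow m).eventually_const_le
      (show 1 - η / 2 < 1 by linarith), Filter.eventually_gt_atTop 0] with n hn hn0
    rw [le_div_iff₀ (by positivity)] at hn
    refine hn.trans (le_of_eq ?_)
    exact_mod_cast (Nat.descFactorial_eq_factorial_mul_choose n m).symm
  have hF : ∀ᶠ n : ℕ in Filter.atTop, (n : ℝ) ≤ η * γ₀ * (n : ℝ) ^ k / k.factorial := by
    filter_upwards [Filter.eventually_ge_atTop ⌈k.factorial / (η * γ₀)⌉₊,
      Filter.eventually_gt_atTop 0] with n hn hn0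
    have h1 := (Nat.ceil_le.1 hn)
    rw [div_le_iff₀ (by positivity)] at h1
    have hn1 : (1 : ℝ) ≤ n := by exact_mod_cast hn0
    rw [le_div_iff₀ (by positivity)]
    calc (n : ℝ) * k.factorial ≤ n * (n * (η * γ₀)) := by gcongr
      _ = η * γ₀ * (n : ℝ) ^ 2 := by ring
      _ ≤ _ := by
        gcongr
        omega
  have hG : ∀ᶠ n : ℕ in Filter.atTop, (n : ℝ) ^ (k - 1) / (k - 1).factorial ≤
      (1 + γ / 2) * n.choose (k - 1) := by
    have := (tendsto_factorial_mul_choose_div_pow (k - 1)).const_mul (1 + γ / 2)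
    rw [mul_one] at this
    filter_upwards [this.eventually_const_le (show 1 < 1 + γ / 2 by linarith),
      Filter.eventually_gt_atTop 0] with n hn hn0
    rw [← mul_div_assoc, le_div_iff₀ (by positivity)] at hn
    rw [div_le_iff₀ (by positivity)]
    linarith
  filter_upwards [hD, hE, hF, hG, Filter.eventually_gt_atTop 0] with n hnD hnE hnF hnG hn0
  intro H hH hdeg
  obtain ⟨G, hG1, hG2⟩ := exists_many_pullback_hyperPM hn0 hlk hkm hH
    (b := (δ + ε / 2) * m.choose (k - l)) (t := ε / 4 * m.choose (k - l)) (by positivity) hdeg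
    (by
      calc _ = (δ + 3 * ε / 4) * m.choose (k - l) * (n : ℝ) ^ (k - l) := by ring
        _ ≤ (δ + 7 * ε / 8) * (m - l).choose (k - l) * (n : ℝ) ^ (k - l) := by gcongr
        _ = (m - l).choose (k - l) * ((δ + 7 * ε / 8) * (n : ℝ) ^ (k - l)) := by ring
        _ ≤ _ := by gcongr) hm1
  have hGcard : (1 - η) * (n : ℝ) ^ m ≤ G.card := by
    have := mul_le_mul_of_nonneg_right hm3 (by positivity : (0 : ℝ) ≤ (n : ℝ) ^ m)
    linarith
  obtain ⟨H', hH', h1, h2⟩ := exists_subhypergraph_of_pullback hn0 hk0 hm0 hkm hH G hG1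
  refine ⟨H', hH', ?_, fun v => ?_⟩
  · have h3 : (1 - η) * γ₀ * ((n : ℝ) ^ k / k.factorial) ≤ H'.card + n := by
      refine le_trans ?_ h1
      rw [← hK, hγ₀, hkfac, le_div_iff₀ (by positivity)]
      calc _ = (1 - η) * ((n : ℝ) ^ k * (n : ℝ) ^ (m - k)) * m := by field_simp
        _ = (1 - η) * (n : ℝ) ^ m * m := by rw [← pow_add, Nat.add_sub_cancel' hkm]
        _ ≤ _ := by gcongr
    have h4 : (n.choose k : ℝ) ≤ (n : ℝ) ^ k / k.factorial := Nat.choose_le_pow_div k n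
    calc (1 - 2 * η) * γ₀ * n.choose k
        ≤ (1 - 2 * η) * γ₀ * ((n : ℝ) ^ k / k.factorial) := by gcongr
      _ = (1 - η) * γ₀ * ((n : ℝ) ^ k / k.factorial) - η * γ₀ * (n : ℝ) ^ k / k.factorial := by
          ring
      _ ≤ _ := by linarith
  · calc (hDeg H' {v} : ℝ) ≤ m * (n : ℝ) ^ (k - 1) / K := h2 v
      _ = γ₀ * ((n : ℝ) ^ (k - 1) / (k - 1).factorial) := by rw [hγ₀]; field_simp
      _ ≤ γ₀ * ((1 + γ / 2) * n.choose (k - 1)) := by gcongr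
      _ = _ := by rw [← hγη]; ring
end
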